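/- arXiv:1806.00689 — 3 statements merged into one kernel-verified Lean document; each statement's English description precedes it below -/
import Mathlib

section
/- Let I be a nonempty finite set of positive integers, m = max(I), and I⁻ = I ∖ {m}. Then the descent polynomials satisfy the identity d(I,n) = C(n,m)·d(I⁻,m) − d(I⁻,n) as polynomials in n (equivalently, the two sides agree at every integer n > m), where C(n,m) is the binomial coefficient and d(I⁻,m) is the (integer) number of permutations of {1,…,m} with descent set I⁻. -/
/-- The descent set of a permutation of `{1,…,n}` (modeled on `Fin n`), as a set of
1-indexed positions `i ∈ {1, …, n-1}` with `π_i > π_{i+1}`. -/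
noncomputable def descSet (n : ℕ) (π : Equiv.Perm (Fin n)) : Finset ℕ :=
  @Finset.filter _
    (fun i => ∃ (h1 : i - 1 < n) (h2 : i < n), π ⟨i, h2⟩ < π ⟨i - 1, h1⟩)
    (Classical.decPred _) (Finset.Ioo 0 n)

/-- `dCount I n` is the number of permutations of `{1,…,n}` with descent set `I`. -/
noncomputable def dCount (I : Finset ℕ) (n : ℕ) : ℕ :=
  Nat.card {π : Equiv.Perm (Fin n) // descSet n π = I}

/-- `mI I = max (I ∪ {0})`. -/
def mI (I : Finset ℕ) : ℕ := I.sup id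

theorem mem_descSet_iff (n : ℕ) (π : Equiv.Perm (Fin n)) (i : ℕ) :
    i ∈ descSet n π ↔ 0 < i ∧ ∃ (h1 : i - 1 < n) (h2 : i < n), π ⟨i, h2⟩ < π ⟨i - 1, h1⟩ := by
  unfold descSet
  rw [@Finset.mem_filter _ _ (Classical.decPred _), Finset.mem_Ioo]
  constructor
  · rintro ⟨⟨h, _⟩, h'⟩; exact ⟨h, h'⟩
  · rintro ⟨h, h1, h2, h'⟩; exact ⟨⟨h, h2⟩, h1, h2, h'⟩

theorem compl_card_aux {m k : ℕ} {S : Finset (Fin (m + k))} (hS : S.card = m) :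
    Sᶜ.card = k := by
  rw [Finset.card_compl, Fintype.card_fin, hS]; omega

/-- The permutation whose first `m` values form `S` in the order given by `σ`, and whose
remaining values increase. -/
noncomputable def glue {m k : ℕ} (S : Finset (Fin (m + k))) (hS : S.card = m)
    (σ : Equiv.Perm (Fin m)) : Equiv.Perm (Fin (m + k)) :=
  finSumFinEquiv.symm.trans
    ((Equiv.sumCongr σ (Equiv.refl (Fin k))).trans (finSumEquivOfFinset hS (compl_card_aux hS)))

theorem glue_left {m k : ℕ} (S : Finset (Fin (m + k))) (hS : S.card = m)
    (σ : Equiv.Perm (Fin m)) (i : Fin m) :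
    glue S hS σ (Fin.castAdd k i) = S.orderEmbOfFin hS (σ i) := by
  simp [glue]

theorem glue_right {m k : ℕ} (S : Finset (Fin (m + k))) (hS : S.card = m)
    (σ : Equiv.Perm (Fin m)) (j : Fin k) :
    glue S hS σ (Fin.natAdd m j) = Sᶜ.orderEmbOfFin (compl_card_aux hS) j := by
  simp [glue]

theorem descSet_glue {m k : ℕ} (S : Finset (Fin (m + k))) (hS : S.card = m)
    (σ : Equiv.Perm (Fin m)) :
    (descSet (m + k) (glue S hS σ)).erase m = descSet m σ := by
  ext i
  rw [Finset.mem_erase, mem_descSet_iff, mem_descSet_iff]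
  constructor
  · rintro ⟨hne, h0, h1, h2, h⟩
    refine ⟨h0, ?_⟩
    rcases lt_or_gt_of_ne hne with hlt | hgt
    · refine ⟨by omega, hlt, ?_⟩
      have e1 := glue_left S hS σ ⟨i, hlt⟩
      have e2 := glue_left S hS σ ⟨i - 1, by omega⟩
      simp only [Fin.castAdd_mk] at e1 e2
      rw [e1, e2] at h
      simpa using h
    · exfalso
      have e1 := glue_right S hS σ ⟨i - m, by omega⟩
      have e2 := glue_right S hS σ ⟨i - 1 - m, by omega⟩
      simp only [Fin.natAdd_mk, show m + (i - m) = i by omega,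
        show m + (i - 1 - m) = i - 1 by omega] at e1 e2
      rw [e1, e2, OrderEmbedding.lt_iff_lt, Fin.mk_lt_mk] at h
      omega
  · rintro ⟨h0, h1, h2, h⟩
    refine ⟨by omega, h0, by omega, by omega, ?_⟩
    have e1 := glue_left S hS σ ⟨i, h2⟩
    have e2 := glue_left S hS σ ⟨i - 1, h1⟩
    simp only [Fin.castAdd_mk] at e1 e2
    rw [e1, e2]
    simpa using h

theorem image_glue {m k : ℕ} (S : Finset (Fin (m + k))) (hS : S.card = m)
    (σ : Equiv.Perm (Fin m)) :
    Finset.univ.image (fun i : Fin m => glue S hS σ (Fin.castAdd k i)) = S := by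
  apply Finset.eq_of_subset_of_card_le
  · intro x hx
    obtain ⟨i, _, rfl⟩ := Finset.mem_image.1 hx
    rw [glue_left]
    exact Finset.orderEmbOfFin_mem _ _ _
  · have hinj : Function.Injective (fun i : Fin m => glue S hS σ (Fin.castAdd k i)) :=
      (glue S hS σ).injective.comp (Fin.castAdd_injective m k)
    rw [Finset.card_image_of_injective _ hinj]
    simp [hS]

theorem glue_inj {m k : ℕ} (S T : Finset (Fin (m + k))) (hS : S.card = m) (hT : T.card = m)
    (σ τ : Equiv.Perm (Fin m)) (h : glue S hS σ = glue T hT τ) : S = T ∧ σ = τ := by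
  have hST : S = T := by rw [← image_glue S hS σ, h, image_glue]
  subst hST
  refine ⟨rfl, Equiv.ext fun i => ?_⟩
  have := glue_left S hS σ i
  rw [h, glue_left] at this
  exact ((S.orderEmbOfFin hS).injective this).symm

theorem glue_surj {m k : ℕ} (π : Equiv.Perm (Fin (m + k)))
    (h : ∀ i ∈ descSet (m + k) π, i ≤ m) :
    ∃ S : Finset (Fin (m + k)), ∃ hS : S.card = m, ∃ σ, glue S hS σ = π := by
  have hinj : Function.Injective (fun i : Fin m => π (Fin.castAdd k i)) :=
    π.injective.comp (Fin.castAdd_injective m k)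
  have hmono : StrictMono (fun j : Fin k => π (Fin.natAdd m j)) := by
    cases k with
    | zero => exact fun a => a.elim0
    | succ k =>
      rw [Fin.strictMono_iff_lt_succ]
      intro j
      by_contra hcon
      have hne : π (Fin.natAdd m j.succ) ≠ π (Fin.natAdd m j.castSucc) := by
        intro he
        have := π.injective he
        simp [Fin.ext_iff] at this
      have hlt := lt_of_le_of_ne (not_lt.1 hcon) hne
      have hj := j.2
      have := h (m + j + 1) ((mem_descSet_iff _ _ _).2
        ⟨by omega, by omega, by omega, hlt⟩)
      omega
  set S := Finset.univ.image (fun i : Fin m => π (Fin.castAdd k i)) with hSdef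
  have hS : S.card = m := by
    rw [hSdef, Finset.card_image_of_injective _ hinj]; simp
  have hmem : ∀ i : Fin m, π (Fin.castAdd k i) ∈ S := fun i =>
    Finset.mem_image_of_mem _ (Finset.mem_univ i)
  let f : Fin m → Fin m := fun i => (S.orderIsoOfFin hS).symm ⟨π (Fin.castAdd k i), hmem i⟩
  have hf : Function.Injective f := by
    intro a b hab
    have := (S.orderIsoOfFin hS).symm.injective hab
    exact hinj (Subtype.ext_iff.1 this)
  refine ⟨S, hS, Equiv.ofBijective f (Finite.injective_iff_bijective.1 hf), ?_⟩
  ext x : 1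
  refine Fin.addCases (fun i => ?_) (fun j => ?_) x
  · rw [glue_left, Equiv.ofBijective_apply, ← Finset.coe_orderIsoOfFin_apply]
    simp [f]
  · rw [glue_right]
    have := Finset.orderEmbOfFin_unique (compl_card_aux hS)
      (f := fun j : Fin k => π (Fin.natAdd m j)) (fun j => ?_) hmono
    · exact (congrFun this j).symm
    · rw [Finset.mem_compl, hSdef, Finset.mem_image]
      rintro ⟨i, _, hi⟩
      have := π.injective hi
      simp [Fin.ext_iff] at this
      omega

theorem card_glued (m k : ℕ) (J : Finset ℕ) (hJ : ∀ i ∈ J, i < m) :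
    Nat.card {π : Equiv.Perm (Fin (m + k)) // (descSet (m + k) π).erase m = J} =
      (m + k).choose m * dCount J m := by
  have e : Nat.card {S : Finset (Fin (m + k)) // S.card = m} = (m + k).choose m := by
    rw [Nat.card_eq_fintype_card, Fintype.card_finset_len, Fintype.card_fin]
  rw [← e, dCount, ← Nat.card_prod]
  symm
  apply Nat.card_congr
  refine Equiv.ofBijective
    (fun p => ⟨glue p.1.1 p.1.2 p.2.1, (descSet_glue _ _ _).trans p.2.2⟩) ⟨?_, ?_⟩
  · rintro ⟨⟨S, hS⟩, ⟨σ, hσ⟩⟩ ⟨⟨T, hT⟩, ⟨τ, hτ⟩⟩ h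
    obtain ⟨h1, h2⟩ := glue_inj S T hS hT σ τ (Subtype.ext_iff.1 h)
    subst h1 h2
    rfl
  · rintro ⟨π, hπ⟩
    obtain ⟨S, hS, σ, rfl⟩ := glue_surj π (fun i hi => by
      by_contra hc
      have := hJ i (hπ ▸ Finset.mem_erase.2 ⟨by omega, hi⟩)
      omega)
    exact ⟨⟨⟨S, hS⟩, ⟨σ, (descSet_glue S hS σ).symm.trans hπ⟩⟩, rfl⟩

theorem card_split (n m : ℕ) (I : Finset ℕ) (hm : m ∈ I) :
    Nat.card {π : Equiv.Perm (Fin n) // (descSet n π).erase m = I.erase m} =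
      dCount I n + dCount (I.erase m) n := by
  classical
  unfold dCount
  simp only [Nat.card_eq_fintype_card]
  rw [← Fintype.card_subtype_or_disjoint]
  · apply Fintype.card_congr
    apply Equiv.subtypeEquivRight
    intro π
    constructor
    · intro h
      by_cases hd : m ∈ descSet n π
      · left; rw [← Finset.insert_erase hd, h, Finset.insert_erase hm]
      · right; rw [← h, Finset.erase_eq_of_notMem hd]
    · rintro (h | h) <;> simp [h]
  · rw [Pi.disjoint_iff]
    intro π
    rw [Prop.disjoint_iff]
    rintro ⟨h1, h2⟩
    rw [h1] at h2
    rw [h2] at hm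
    simp at hm

/-- For nonempty finite `I ⊆ ℤ⁺` with `m = max I` and `I⁻ = I \ {m}`,
the identity `d(I,n) = C(n,m)·d(I⁻,m) − d(I⁻,n)` holds at every integer `n > m`
(equivalently, as polynomials in `n`). -/
theorem stmt0 (I : Finset ℕ) (hI : I.Nonempty) (hpos : ∀ i ∈ I, 0 < i) :
    ∀ n : ℕ, mI I < n →
      (dCount I n : ℤ) =
        (n.choose (mI I) : ℤ) * (dCount (I.erase (mI I)) (mI I) : ℤ)
          - (dCount (I.erase (mI I)) n : ℤ) := by
  intro n hn
  have hm : mI I ∈ I := by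
    obtain ⟨i, hi, h⟩ := Finset.exists_mem_eq_sup I hI id
    unfold mI
    rw [h]
    exact hi
  have hle : ∀ i ∈ I, i ≤ mI I := fun i hi => Finset.le_sup (f := id) hi
  obtain ⟨k, rfl⟩ := Nat.exists_eq_add_of_le hn.le
  have h1 := card_glued (mI I) k (I.erase (mI I)) (fun i hi =>
    lt_of_le_of_ne (hle i (Finset.mem_of_mem_erase hi)) (Finset.ne_of_mem_erase hi))
  rw [card_split _ _ I hm] at h1
  have h2 : ((dCount I (mI I + k) + dCount (I.erase (mI I)) (mI I + k) : ℕ) : ℤ) = _ :=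
    congrArg Nat.cast h1
  push_cast at h2
  linarith
end

section
/- Let P be a finite partially ordered set and v ∈ P a fixed element. For 0 ≤ k ≤ |P|−1 let h_k(P,v) be the number of order-preserving bijections φ from P to the chain {1 < 2 < ⋯ < |P|} with φ(v) = k+1. Then the sequence {h_k(P,v)}_{k=0}^{|P|−1} is log-concave. Moreover, if every element of P that is comparable with v and distinct from v is greater than v in P, then the sequence {h_k(P,v)}_{k=0}^{|P|−1} is also decreasing (h_0 ≥ h_1 ≥ ⋯ ≥ h_{|P|−1}). -/
/-- `hgt P v k` is the number of order-preserving bijections `φ` from the finite poset `P`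
to the chain `{1 < 2 < ⋯ < |P|}` (modeled as `Fin (card P)`) with `φ(v) = k + 1`
(i.e. with `v` sent to the `(k+1)`-st element of the chain). -/
noncomputable def hgt (P : Type*) [Fintype P] [PartialOrder P] (v : P) (k : ℕ) : ℕ :=
  Nat.card {φ : P ≃ Fin (Fintype.card P) // Monotone ⇑φ ∧ ((φ v : Fin (Fintype.card P)) : ℕ) = k}



lemma st_eig {ι : Type*} [Fintype ι] [DecidableEq ι] (M : ι → ι → ℝ) (d : ι → ℝ)
    (sym : ∀ i j, M i j = M j i) (hd : ∀ i, 0 < d i) :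
    ∃ (l : ι → ℝ) (e : ι → ι → ℝ), (∀ k i, ∑ j, M i j * e k j = l k * d i * e k i) ∧
      (∀ k, ∑ i, d i * e k i * e k i = 1) ∧
      (∀ v : ι → ℝ, ∑ i, ∑ j, M i j * v i * v j = ∑ k, l k * (∑ i, d i * e k i * v i) ^ 2) := by
  set s : ι → ℝ := fun i => √(d i) with hs
  have hs0 : ∀ i, 0 < s i := fun i => Real.sqrt_pos.2 (hd i)
  have hss : ∀ i, s i * s i = d i := fun i => Real.mul_self_sqrt (hd i).le
  let A : Matrix ι ι ℝ := Matrix.of fun i j => M i j / (s i * s j)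
  have hA : A.IsHermitian := by
    ext i j
    simp [A, sym j i, mul_comm]
  let E := hA.eigenvectorBasis
  have hE : ∀ k i, ∑ j, M i j / (s i * s j) * E k j = hA.eigenvalues k * E k i := by
    intro k i
    have := congrFun (hA.mulVec_eigenvectorBasis k) i
    simpa [Matrix.mulVec, dotProduct, A] using this
  refine ⟨hA.eigenvalues, fun k i => E k i / s i, ?_, ?_, ?_⟩
  · intro k i
    have := hE k i
    calc ∑ j, M i j * (E k j / s j) = s i * ∑ j, M i j / (s i * s j) * E k j := by
          rw [Finset.mul_sum]; refine Finset.sum_congr rfl fun j _ => ?_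
          have := (hs0 i).ne'; have := (hs0 j).ne'; field_simp
      _ = _ := by rw [this, ← hss]; have := (hs0 i).ne'; field_simp
  · intro k
    have h1 : inner ℝ (E k) (E k) = (1:ℝ) := by
      have := E.orthonormal.1 k
      rw [real_inner_self_eq_norm_sq, this]; norm_num
    rw [← h1, PiLp.inner_apply]
    refine Finset.sum_congr rfl fun i _ => ?_
    rw [← hss]; have := (hs0 i).ne'; simp; field_simp
  · intro v
    let x : EuclideanSpace ℝ ι := WithLp.toLp 2 fun i => s i * v i
    have hc : ∀ k, ∑ i, d i * (E k i / s i) * v i = inner ℝ (E k) x := by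
      intro k
      rw [PiLp.inner_apply]
      refine Finset.sum_congr rfl fun i _ => ?_
      rw [← hss]; have := (hs0 i).ne'; simp [x]; field_simp
    have hx : ∀ j, s j * v j = ∑ k, inner ℝ (E k) x * E k j := by
      intro j
      have := E.sum_repr' x
      have := congrArg (fun y : EuclideanSpace ℝ ι => y j) this
      simpa [x] using this.symm
    simp_rw [hc]
    calc ∑ i, ∑ j, M i j * v i * v j
        = ∑ i, (s i * v i) * ∑ j, M i j / (s i * s j) * (s j * v j) := by
          refine Finset.sum_congr rfl fun i _ => ?_
          rw [Finset.mul_sum]; refine Finset.sum_congr rfl fun j _ => ?_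
          have := (hs0 i).ne'; have := (hs0 j).ne'; field_simp
      _ = ∑ i, (s i * v i) * ∑ k, inner ℝ (E k) x * (hA.eigenvalues k * E k i) := by
          refine Finset.sum_congr rfl fun i _ => ?_
          congr 1
          simp_rw [hx, ← hE, Finset.mul_sum]
          rw [Finset.sum_comm]
          refine Finset.sum_congr rfl fun j _ => Finset.sum_congr rfl fun k _ => ?_
          ring
      _ = ∑ k, hA.eigenvalues k * inner ℝ (E k) x * ∑ i, (s i * v i) * E k i := by
          simp_rw [Finset.mul_sum]
          rw [Finset.sum_comm]
          refine Finset.sum_congr rfl fun j _ => Finset.sum_congr rfl fun k _ => ?_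
          ring
      _ = _ := by
          refine Finset.sum_congr rfl fun k _ => ?_
          have : ∑ i, (s i * v i) * E k i = inner ℝ (E k) x := by
            rw [PiLp.inner_apply]
            refine Finset.sum_congr rfl fun i _ => ?_
            simp [x]
          rw [this]; ring

lemma st_locglob {ι : Type*} [Fintype ι] (M : ι → ι → ℝ)
    (sym : ∀ i j, M i j = M j i) (nn : ∀ i j, 0 ≤ M i j) (h : ι → ℝ) (hpos : ∀ i, 0 < h i)
    (conn : ∀ v : ι → ℝ, (∀ i j, 0 < M i j → v i = v j) →
      ∀ i j, (0 < ∑ k, M i k * h k) → (0 < ∑ k, M j k * h k) → v i = v j)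
    (ineq : ∀ v : ι → ℝ, ∑ i, ∑ j, M i j * v i * v j ≤
      ∑ i, h i * (∑ j, M i j * v j) ^ 2 / (∑ j, M i j * h j)) :
    ∀ v : ι → ℝ, ∑ i, (∑ j, M i j * h j) * v i = 0 → ∑ i, ∑ j, M i j * v i * v j ≤ 0 := by
  classical
  intro v hv
  set R : ι → ℝ := fun i => ∑ j, M i j * h j with hR
  have hR0 : ∀ i, 0 ≤ R i := fun i => Finset.sum_nonneg fun j _ => mul_nonneg (nn i j) (hpos j).le
  have hz : ∀ i, R i = 0 → ∀ j, M i j = 0 := by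
    intro i hi j
    have := (Finset.sum_eq_zero_iff_of_nonneg
      (fun j _ => mul_nonneg (nn i j) (hpos j).le)).1 hi j (Finset.mem_univ j)
    rcases mul_eq_zero.1 this with h1 | h1
    · exact h1
    · exact absurd h1 (hpos j).ne'
  let d : ι → ℝ := fun i => if R i = 0 then 1 else R i / h i
  have hd : ∀ i, 0 < d i := by
    intro i
    by_cases hi : R i = 0
    · simp [d, hi]
    · simp only [d, hi, if_false]
      exact div_pos (lt_of_le_of_ne (hR0 i) (Ne.symm hi)) (hpos i)
  obtain ⟨l, e, he1, he2, he3⟩ := st_eig M d sym hd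
  rw [he3]
  refine Finset.sum_nonpos fun k _ => ?_
  have hQ : ∑ i, ∑ j, M i j * e k i * e k j = l k := by
    calc ∑ i, ∑ j, M i j * e k i * e k j = ∑ i, e k i * ∑ j, M i j * e k j := by
          refine Finset.sum_congr rfl fun i _ => ?_
          rw [Finset.mul_sum]
          refine Finset.sum_congr rfl fun j _ => ?_
          ring
      _ = l k * ∑ i, d i * e k i * e k i := by
          rw [Finset.mul_sum]
          refine Finset.sum_congr rfl fun i _ => ?_
          rw [he1]; ring
      _ = l k := by rw [he2, mul_one]
  have h1 : l k ≤ l k ^ 2 := by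
    have := ineq (e k)
    rw [hQ] at this
    refine this.trans ?_
    calc ∑ i, h i * (∑ j, M i j * e k j) ^ 2 / R i ≤ ∑ i, l k ^ 2 * (d i * e k i * e k i) := by
          refine Finset.sum_le_sum fun i _ => ?_
          have hdi := (hd i).le
          by_cases hi : R i = 0
          · rw [hi, div_zero]
            have : 0 ≤ d i * (e k i * e k i) := mul_nonneg hdi (mul_self_nonneg _)
            rw [mul_assoc (d i)]; positivity
          · rw [he1]
            have : d i = R i / h i := by simp [d, hi]
            rw [this]
            have := (hpos i).ne'
            apply le_of_eq; field_simp
      _ = l k ^ 2 := by rw [← Finset.mul_sum, he2, mul_one]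
  set g : ι → ℝ := fun i => e k i / h i with hg
  have key : 1 - l k = (1/2) * ∑ i, ∑ j, M i j * h i * h j * (g i - g j) ^ 2
      + ∑ i, (if R i = 0 then (e k i) ^ 2 else 0) := by
    have hA : ∑ i, ∑ j, M i j * h i * h j * (g i - g j) ^ 2
        = ∑ i, ∑ j, (M i j * h i * h j * (g i) ^ 2) + ∑ i, ∑ j, (M i j * h i * h j * (g j) ^ 2)
          - 2 * ∑ i, ∑ j, M i j * e k i * e k j := by
      rw [Finset.mul_sum, ← Finset.sum_add_distrib, ← Finset.sum_sub_distrib]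
      refine Finset.sum_congr rfl fun i _ => ?_
      rw [Finset.mul_sum, ← Finset.sum_add_distrib, ← Finset.sum_sub_distrib]
      refine Finset.sum_congr rfl fun j _ => ?_
      have := (hpos i).ne'; have := (hpos j).ne'
      simp only [hg]; field_simp; ring
    have hB : ∑ i, ∑ j, (M i j * h i * h j * (g j) ^ 2) = ∑ i, ∑ j, (M i j * h i * h j * (g i) ^ 2) := by
      rw [Finset.sum_comm]
      refine Finset.sum_congr rfl fun i _ => Finset.sum_congr rfl fun j _ => ?_
      rw [sym j i]; ring
    have hC : ∑ i, ∑ j, (M i j * h i * h j * (g i) ^ 2) + ∑ i, (if R i = 0 then (e k i) ^ 2 else 0) = 1 := by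
      rw [← he2 k, ← Finset.sum_add_distrib]
      refine Finset.sum_congr rfl fun i _ => ?_
      have : ∑ j, (M i j * h i * h j * (g i) ^ 2) = h i * (g i) ^ 2 * R i := by
        rw [hR, Finset.mul_sum]
        refine Finset.sum_congr rfl fun j _ => ?_
        ring
      rw [this]
      by_cases hi : R i = 0
      · simp [d, hi]; ring
      · have := (hpos i).ne'
        simp only [d, hi, if_false, hg]; field_simp; ring
    rw [hA, hB, hQ]
    linarith
  have hn1 : ∀ i j, 0 ≤ M i j * h i * h j * (g i - g j) ^ 2 := fun i j =>
    mul_nonneg (mul_nonneg (mul_nonneg (nn i j) (hpos i).le) (hpos j).le) (sq_nonneg _)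
  have hs1 : 0 ≤ ∑ i, ∑ j, M i j * h i * h j * (g i - g j) ^ 2 :=
    Finset.sum_nonneg fun i _ => Finset.sum_nonneg fun j _ => hn1 i j
  have hn2 : ∀ i, 0 ≤ (if R i = 0 then (e k i) ^ 2 else 0) := by
    intro i; split_ifs
    · positivity
    · exact le_rfl
  have hs2 : 0 ≤ ∑ i, (if R i = 0 then (e k i) ^ 2 else 0) := Finset.sum_nonneg fun i _ => hn2 i
  by_cases hl : l k ≤ 0
  · exact mul_nonpos_of_nonpos_of_nonneg hl (sq_nonneg _)
  have hl1 : l k = 1 := by nlinarith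
  have e1 : ∑ i, ∑ j, M i j * h i * h j * (g i - g j) ^ 2 = 0 := by linarith
  have e2 : ∑ i, (if R i = 0 then (e k i) ^ 2 else 0) = 0 := by linarith
  have c1 : ∀ i j, 0 < M i j → g i = g j := by
    intro i j hij
    have a1 := (Finset.sum_eq_zero_iff_of_nonneg
      (fun i _ => Finset.sum_nonneg fun j _ => hn1 i j)).1 e1 i (Finset.mem_univ i)
    have a2 := (Finset.sum_eq_zero_iff_of_nonneg (fun j _ => hn1 i j)).1 a1 j (Finset.mem_univ j)
    have a3 : 0 < M i j * h i * h j := mul_pos (mul_pos hij (hpos i)) (hpos j)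
    have a4 : (g i - g j) ^ 2 = 0 := by
      rcases mul_eq_zero.1 a2 with h | h
      · exact absurd h a3.ne'
      · exact h
    exact sub_eq_zero.1 (pow_eq_zero_iff (two_ne_zero) |>.1 a4)
  have c2 := conn g c1
  have c3 : ∃ c, ∀ i, R i ≠ 0 → e k i = c * h i := by
    by_cases hex : ∃ i, R i ≠ 0
    · obtain ⟨i0, hi0⟩ := hex
      refine ⟨g i0, fun i hi => ?_⟩
      rw [c2 i0 i (lt_of_le_of_ne (hR0 _) (Ne.symm hi0)) (lt_of_le_of_ne (hR0 _) (Ne.symm hi))]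
      have := (hpos i).ne'
      simp only [hg]; field_simp
    · push Not at hex
      exact ⟨0, fun i hi => absurd (hex i) hi⟩
  obtain ⟨c, hc⟩ := c3
  have : ∑ i, d i * e k i * v i = 0 := by
    rw [← mul_zero c, ← hv, Finset.mul_sum]
    refine Finset.sum_congr rfl fun i _ => ?_
    by_cases hi : R i = 0
    · have := (Finset.sum_eq_zero_iff_of_nonneg (fun i _ => hn2 i)).1 e2 i (Finset.mem_univ i)
      rw [if_pos hi] at this
      have : e k i = 0 := pow_eq_zero_iff (two_ne_zero) |>.1 this
      change d i * e k i * v i = c * (R i * v i)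
      simp [this, hi]
    · rw [hc i hi]
      have := (hpos i).ne'
      change d i * (c * h i) * v i = c * (R i * v i)
      simp only [d, hi, if_false]; field_simp
  rw [this]; simp


section StanleyCombinatorics
open Classical

/-- the order relation (`false`) or its reverse (`true`) -/
def stR {P : Type*} [PartialOrder P] (β : Bool) (x y : P) : Prop :=
  match β with
  | false => x < y
  | true => y < x

/-- `stD z S (x, β)`: the element `x` can be removed from the bottom / top of `S`. -/
def stD {P : Type*} [PartialOrder P] (z : P) (S : Finset P) (i : P × Bool) : Prop :=
  i.1 ∈ S ∧ ¬ stR i.2 z i.1 ∧ ∀ y ∈ S, ¬ stR i.2 y i.1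

noncomputable def stP {P : Type*} [PartialOrder P] (z : P) (S : Finset P) (i j : P × Bool) :
    P × Bool := if stD z S j then j else i

noncomputable def stG {P : Type*} [PartialOrder P] (z : P) (f : Finset P → ℝ) (S : Finset P)
    (i j : P × Bool) : ℝ :=
  if stD z S i ∧ stD z (S.erase i.1) j then f ((S.erase i.1).erase j.1) else 0

noncomputable def stB {P : Type*} [Fintype P] [PartialOrder P] (z : P) (f : Finset P → ℝ)
    (S : Finset P) (g k : P × Bool → ℝ) : ℝ :=
  ∑ i, ∑ j, stG z f S i j * g i * k (stP z S i j)

noncomputable def stL {P : Type*} [Fintype P] [PartialOrder P] (z : P) (c : Bool → ℝ)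
    (f : Finset P → ℝ) (R : Finset P) : ℝ :=
  ∑ w : P × Bool, if stD z R w then c w.2 * f (R.erase w.1) else 0

def stHyp {P : Type*} [Fintype P] [PartialOrder P] (z : P) (f : Finset P → ℝ)
    (S : Finset P) : Prop :=
  ∀ v w, 0 < stB z f S w w → stB z f S v v * stB z f S w w ≤ (stB z f S v w) ^ 2

variable {P : Type*} [PartialOrder P] {z : P} {S : Finset P} {i j w : P × Bool}

lemma stD_erase {x : P} (h : stD z S i) (hx : i.1 ≠ x) : stD z (S.erase x) i :=
  ⟨Finset.mem_erase.2 ⟨hx, h.1⟩, h.2.1, fun y hy => h.2.2 y (Finset.mem_of_mem_erase hy)⟩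

lemma stD_ne {x : P} (h : stD z (S.erase x) i) : i.1 ≠ x := Finset.ne_of_mem_erase h.1

lemma stD_of_two {x y : P} (hxy : x ≠ y) (h1 : stD z (S.erase x) i) (h2 : stD z (S.erase y) i) :
    stD z S i := by
  refine ⟨Finset.mem_of_mem_erase h1.1, h1.2.1, fun u hu => ?_⟩
  by_cases hux : u = x
  · exact h2.2.2 u (Finset.mem_erase.2 ⟨by rw [hux]; exact hxy, hu⟩)
  · exact h1.2.2 u (Finset.mem_erase.2 ⟨hux, hu⟩)

lemma stD_side (hi : stD z S i) (hj : stD z (S.erase i.1) j) (hn : ¬ stD z S j) : i.2 = j.2 := by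
  by_contra hne
  apply hn
  refine ⟨Finset.mem_of_mem_erase hj.1, hj.2.1, fun u hu => ?_⟩
  by_cases hux : u = i.1
  · have := hi.2.2 j.1 (Finset.mem_of_mem_erase hj.1)
    rw [hux]
    revert this hne
    cases i.2 <;> cases j.2 <;> simp [stR]
  · exact hj.2.2 u (Finset.mem_erase.2 ⟨hux, hu⟩)

lemma stP_side (hi : stD z S i) (hj : stD z (S.erase i.1) j) : (stP z S i j).2 = j.2 := by
  unfold stP
  split_ifs with h
  · rfl
  · exact stD_side hi hj h

lemma stG_symm (f : Finset P → ℝ) (i j : P × Bool) :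
    (if stD z S j then stG z f S i j else 0) = if stD z S i then stG z f S j i else 0 := by
  unfold stG
  by_cases hi : stD z S i
  · by_cases hj : stD z S j
    · by_cases h : i.1 = j.1
      · have h1 : ¬ stD z (S.erase i.1) j := fun h' => stD_ne h' h.symm
        have h2 : ¬ stD z (S.erase j.1) i := fun h' => stD_ne h' h
        simp [h1, h2]
      · have h1 : stD z (S.erase i.1) j := stD_erase hj (Ne.symm h)
        have h2 : stD z (S.erase j.1) i := stD_erase hi h
        simp [h1, h2, hi, hj, Finset.erase_right_comm]
    · simp [hj]
  · simp [hi]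

variable [Fintype P]

lemma stB_symm (f : Finset P → ℝ) (g k : P × Bool → ℝ) : stB z f S g k = stB z f S k g := by
  have h : ∀ g k : P × Bool → ℝ, stB z f S g k =
      ∑ i, ∑ j, (if stD z S j then stG z f S i j else 0) * g i * k j +
      ∑ i, ∑ j, (if stD z S j then 0 else stG z f S i j) * (g i * k i) := by
    intro g k
    unfold stB
    rw [← Finset.sum_add_distrib]
    refine Finset.sum_congr rfl fun i _ => ?_
    rw [← Finset.sum_add_distrib]
    refine Finset.sum_congr rfl fun j _ => ?_
    unfold stP
    split_ifs <;> ring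
  rw [h, h]
  congr 1
  · rw [Finset.sum_comm]
    refine Finset.sum_congr rfl fun i _ => Finset.sum_congr rfl fun j _ => ?_
    rw [stG_symm]; ring
  · refine Finset.sum_congr rfl fun i _ => Finset.sum_congr rfl fun j _ => ?_
    ring

lemma stB_row (c : Bool → ℝ) (f : Finset P → ℝ) (k : P × Bool → ℝ) (hi : stD z S i) :
    ∑ j, stG z (stL z c f) S i j * k (stP z S i j) =
      stB z f (S.erase i.1) (fun j => k (stP z S i j)) (fun j => c j.2) := by
  unfold stB
  refine Finset.sum_congr rfl fun j _ => ?_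
  unfold stG stL
  by_cases hj : stD z (S.erase i.1) j
  · rw [if_pos ⟨hi, hj⟩, Finset.sum_mul]
    refine Finset.sum_congr rfl fun w _ => ?_
    by_cases hw : stD z ((S.erase i.1).erase j.1) w
    · rw [if_pos hw, if_pos ⟨hj, hw⟩]
      simp only [stP_side hj hw]; ring
    · simp [hw]
  · simp [hj]

lemma stB_zero_row (f : Finset P → ℝ) (hi : ¬ stD z S i) (j : P × Bool) : stG z f S i j = 0 := by
  simp [stG, hi]

lemma st_pull (c : Bool → ℝ) (hc : ∀ β, 0 < c β) (f : Finset P → ℝ) (hf : ∀ R, 0 ≤ f R)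
    (v : P × Bool → ℝ) :
    stB z (stL z c f) S v v ≤ ∑ i, if stD z S i then
      c i.2 * stB z f (S.erase i.1) (fun j => v (stP z S i j)) (fun j => v (stP z S i j)) else 0 := by
  let T : P × Bool → P × Bool → P × Bool → ℝ := fun i j w =>
    if stD z S i then stG z f (S.erase i.1) j w else 0
  let V : P × Bool → P × Bool → P × Bool → ℝ := fun i j w =>
    v (stP z S i (stP z (S.erase i.1) j w))
  have h1 : stB z (stL z c f) S v v = ∑ i, ∑ j, ∑ w, T i j w * (v i * c j.2 * V i j w) := by
    have : stB z (stL z c f) S v v =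
        ∑ i, v i * ∑ j, stG z (stL z c f) S i j * v (stP z S i j) := by
      unfold stB
      refine Finset.sum_congr rfl fun i _ => ?_
      rw [Finset.mul_sum]
      refine Finset.sum_congr rfl fun j _ => ?_
      ring
    rw [this]
    refine Finset.sum_congr rfl fun i _ => ?_
    by_cases hi : stD z S i
    · rw [stB_row c f v hi, stB_symm]
      unfold stB
      rw [Finset.mul_sum]
      refine Finset.sum_congr rfl fun j _ => ?_
      rw [Finset.mul_sum]
      refine Finset.sum_congr rfl fun w _ => ?_
      simp only [T, V, hi, if_true]; ring
    · simp [T, hi, stB_zero_row]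
  have h2 : (∑ i, if stD z S i then
      c i.2 * stB z f (S.erase i.1) (fun j => v (stP z S i j)) (fun j => v (stP z S i j)) else 0)
      = ∑ i, ∑ j, ∑ w, T i j w * (c i.2 * v (stP z S i j) * V i j w) := by
    refine Finset.sum_congr rfl fun i _ => ?_
    by_cases hi : stD z S i
    · rw [if_pos hi]
      unfold stB
      rw [Finset.mul_sum]
      refine Finset.sum_congr rfl fun j _ => ?_
      rw [Finset.mul_sum]
      refine Finset.sum_congr rfl fun w _ => ?_
      simp only [T, V, hi, if_true]; ring
    · simp [T, hi]
  let T' : P × Bool → P × Bool → P × Bool → ℝ := fun i j w =>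
    if stD z S i ∧ stD z S j ∧ i.1 ≠ j.1 ∧ stD z ((S.erase i.1).erase j.1) w then
      f (((S.erase i.1).erase j.1).erase w.1) else 0
  have hT' : ∀ i j w, T' i j w = T' j i w := by
    intro i j w
    simp only [T']
    rw [Finset.erase_right_comm]
    congr 1
    rw [eq_iff_iff]
    tauto
  have hT'0 : ∀ i j w, 0 ≤ T' i j w := by
    intro i j w
    simp only [T']
    split_ifs
    · exact hf _
    · exact le_rfl
  let X : P × Bool → P × Bool → P × Bool → ℝ := fun i j w =>
    T' i j w * ((c i.2 * v j - v i * c j.2) * V i j w)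
  have h3 : (∑ i, ∑ j, ∑ w, T i j w * (c i.2 * v (stP z S i j) * V i j w)) -
      (∑ i, ∑ j, ∑ w, T i j w * (v i * c j.2 * V i j w)) = ∑ i, ∑ j, ∑ w, X i j w := by
    simp only [← Finset.sum_sub_distrib]
    refine Finset.sum_congr rfl fun i _ => Finset.sum_congr rfl fun j _ =>
      Finset.sum_congr rfl fun w _ => ?_
    simp only [X, T, T', stG]
    by_cases hi : stD z S i
    · by_cases hj : stD z (S.erase i.1) j
      · by_cases hw : stD z ((S.erase i.1).erase j.1) w
        · by_cases hj' : stD z S j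
          · simp only [hi, hj, hw, hj', stP, (stD_ne hj).symm, if_true, and_self, ne_eq,
              not_false_eq_true]
            ring
          · simp only [hi, hj, hw, hj', stP, if_true, and_self, if_false, false_and, and_false,
              stD_side hi hj hj']
            ring
        · simp [hw]
      · have : ¬ (stD z S j ∧ i.1 ≠ j.1) := fun h => hj (stD_erase h.1 (Ne.symm h.2))
        have h' : ¬ (stD z S i ∧ stD z S j ∧ i.1 ≠ j.1 ∧ stD z ((S.erase i.1).erase j.1) w) := by
          tauto
        simp [hj, h']
    · simp [hi]
  have h4 : ∑ i, ∑ j, ∑ w, X i j w = ∑ i, ∑ j, ∑ w, X j i w := Finset.sum_comm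
  have h5 : 0 ≤ ∑ i, ∑ j, ∑ w, (X i j w + X j i w) := by
    refine Finset.sum_nonneg fun i _ => Finset.sum_nonneg fun j _ =>
      Finset.sum_nonneg fun w _ => ?_
    have e : X i j w + X j i w = T' i j w * ((c i.2 * v j - v i * c j.2) * (V i j w - V j i w)) := by
      simp only [X]; rw [hT' j i w]; ring
    rw [e]
    by_cases hcond : stD z S i ∧ stD z S j ∧ i.1 ≠ j.1 ∧ stD z ((S.erase i.1).erase j.1) w
    · obtain ⟨hi, hj, hij, hw⟩ := hcond
      refine mul_nonneg (hT'0 _ _ _) ?_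
      have hw' : stD z ((S.erase j.1).erase i.1) w := by rwa [Finset.erase_right_comm]
      have hwj : w.1 ≠ j.1 := stD_ne hw
      have hwi : w.1 ≠ i.1 := stD_ne hw'
      by_cases hwS : stD z S w
      · have a1 := stD_erase hwS hwi
        have a2 := stD_erase hwS hwj
        simp [V, stP, a1, a2, hwS]
      · by_cases a1 : stD z (S.erase i.1) w
        · by_cases a2 : stD z (S.erase j.1) w
          · exact absurd (stD_of_two hij a1 a2) hwS
          · simp [V, stP, a1, a2, hwS, hi]
        · by_cases a2 : stD z (S.erase j.1) w
          · simp [V, stP, a1, a2, hwS, hj]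
          · have s1 : j.2 = w.2 := stD_side (stD_erase hj (Ne.symm hij)) hw a1
            have s2 : i.2 = w.2 := stD_side (stD_erase hi hij) hw' a2
            have b1 : V i j w = v j := by simp [V, stP, a1, hj]
            have b2 : V j i w = v i := by simp [V, stP, a2, hi]
            rw [b1, b2, s1, s2]
            have := (hc w.2).le
            have e2 : (c w.2 * v j - v i * c w.2) * (v j - v i) = c w.2 * (v j - v i) ^ 2 := by ring
            rw [e2]; positivity
    · have : T' i j w = 0 := by simp only [T']; rw [if_neg hcond]
      rw [this, zero_mul]
  simp only [Finset.sum_add_distrib] at h5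
  rw [h1, h2]
  linarith

lemma stG_nonneg (f : Finset P → ℝ) (hf : ∀ R, 0 ≤ f R) (i j : P × Bool) : 0 ≤ stG z f S i j := by
  unfold stG; split_ifs
  · exact hf _
  · exact le_rfl

lemma stL_nonneg (c : Bool → ℝ) (hc : ∀ β, 0 < c β) (f : Finset P → ℝ) (hf : ∀ R, 0 ≤ f R)
    (R : Finset P) : 0 ≤ stL z c f R := by
  unfold stL
  refine Finset.sum_nonneg fun w _ => ?_
  split_ifs
  · exact mul_nonneg (hc _).le (hf _)
  · exact le_rfl

lemma stB_sub_smul (f : Finset P → ℝ) (v w k : P × Bool → ℝ) (s : ℝ) :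
    stB z f S (fun i => v i - s * w i) k = stB z f S v k - s * stB z f S w k := by
  unfold stB
  simp only [Finset.mul_sum, ← Finset.sum_sub_distrib]
  refine Finset.sum_congr rfl fun i _ => Finset.sum_congr rfl fun j _ => ?_
  ring

lemma st_step (c : Bool → ℝ) (hc : ∀ β, 0 < c β) (f : Finset P → ℝ) (hf : ∀ R, 0 ≤ f R)
    (hyp : ∀ i, stD z S i → stHyp z f (S.erase i.1))
    (hconn : ∀ v : P × Bool → ℝ, (∀ i j, stD z S i → stD z S j → i.1 ≠ j.1 →
        0 < stL z c f ((S.erase i.1).erase j.1) → v i = v j) →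
      ∀ i j, (∃ i', stD z S i ∧ stD z (S.erase i.1) i' ∧
          0 < stL z c f ((S.erase i.1).erase i'.1)) →
        (∃ j', stD z S j ∧ stD z (S.erase j.1) j' ∧
          0 < stL z c f ((S.erase j.1).erase j'.1)) → v i = v j) :
    stHyp z (stL z c f) S := by
  set f' := stL z c f with hf'
  have hf'0 : ∀ R, 0 ≤ f' R := stL_nonneg c hc f hf
  let h : P × Bool → ℝ := fun i => c i.2
  let M : P × Bool → P × Bool → ℝ := fun i j =>
    ∑ j', stG z f' S i j' * (if stP z S i j' = j then 1 else 0)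
  have hMrow : ∀ (i : P × Bool) (k : P × Bool → ℝ),
      ∑ j, M i j * k j = ∑ j, stG z f' S i j * k (stP z S i j) := by
    intro i k
    simp only [M, Finset.sum_mul]
    rw [Finset.sum_comm]
    refine Finset.sum_congr rfl fun j' _ => ?_
    rw [Finset.sum_eq_single (stP z S i j')]
    · simp
    · intro b _ hb; simp [Ne.symm hb]
    · intro h; exact absurd (Finset.mem_univ _) h
  have hMB : ∀ v k : P × Bool → ℝ, ∑ i, ∑ j, M i j * v i * k j = stB z f' S v k := by
    intro v k
    unfold stB
    refine Finset.sum_congr rfl fun i _ => ?_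
    have := congrArg (fun x => v i * x) (hMrow i k)
    simp only [Finset.mul_sum] at this
    calc _ = ∑ j, v i * (M i j * k j) := Finset.sum_congr rfl fun j _ => by ring
      _ = _ := this
      _ = _ := Finset.sum_congr rfl fun j _ => by ring
  have hMnn : ∀ i j, 0 ≤ M i j := fun i j => Finset.sum_nonneg fun j' _ =>
    mul_nonneg (stG_nonneg f' hf'0 _ _) (by split_ifs <;> norm_num)
  have hMB1 : ∀ i j, M i j = stB z f' S (Pi.single i 1) (Pi.single j 1) := by
    intro i j
    rw [← hMB]
    rw [Finset.sum_eq_single i, Finset.sum_eq_single j]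
    · simp
    · intro b _ hb; simp [hb]
    · intro h; exact absurd (Finset.mem_univ _) h
    · intro b _ hb; simp [hb]
    · intro h; exact absurd (Finset.mem_univ _) h
  have hMsym : ∀ i j, M i j = M j i := by
    intro i j; rw [hMB1, hMB1, stB_symm]
  have hMpos : ∀ i j, stD z S i → stD z S j → i.1 ≠ j.1 → 0 < f' ((S.erase i.1).erase j.1) →
      0 < M i j := by
    intro i j hi hj hij hp
    have : stG z f' S i j * (if stP z S i j = j then 1 else 0) ≤ M i j :=
      Finset.single_le_sum (f := fun j' => stG z f' S i j' * (if stP z S i j' = j then 1 else 0))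
        (fun j' _ => mul_nonneg (stG_nonneg f' hf'0 _ _) (by split_ifs <;> norm_num))
        (Finset.mem_univ j)
    refine lt_of_lt_of_le ?_ this
    simpa [stG, hi, hj, stD_erase hj (Ne.symm hij), stP] using hp
  have hMsupp : ∀ i, 0 < ∑ k, M i k * h k → ∃ i', stD z S i ∧ stD z (S.erase i.1) i' ∧
          0 < f' ((S.erase i.1).erase i'.1) := by
    intro i hi
    rw [hMrow] at hi
    by_contra hcon
    push Not at hcon
    refine absurd hi (not_lt.2 (le_of_eq (Finset.sum_eq_zero fun j _ => ?_)))
    unfold stG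
    split_ifs with hd
    · have := hcon j hd.1 hd.2
      rw [le_antisymm this (hf'0 _), zero_mul]
    · rw [zero_mul]
  have hhp : ∀ i, stD z S i → stB z f (S.erase i.1) (fun j => h (stP z S i j)) h
      = stB z f (S.erase i.1) h h := by
    intro i hi
    unfold stB
    refine Finset.sum_congr rfl fun j _ => Finset.sum_congr rfl fun w _ => ?_
    by_cases hj : stD z (S.erase i.1) j
    · simp only [h, stP_side hi hj]
    · simp [stB_zero_row, hj]
  have main := st_locglob M hMsym hMnn h (fun i => hc _) (by
      intro v hv i j hi hj
      refine hconn v ?_ i j (hMsupp i hi) (hMsupp j hj)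
      intro i j h1 h2 h3 h4
      exact hv i j (hMpos i j h1 h2 h3 h4)) (by
      intro v
      rw [hMB]
      refine (st_pull c hc f hf v).trans ?_
      refine Finset.sum_le_sum fun i _ => ?_
      rw [hMrow, hMrow]
      split_ifs with hi
      · rw [stB_row c f v hi, stB_row c f h hi, hhp i hi]
        have hnn : 0 ≤ stB z f (S.erase i.1) h h :=
          Finset.sum_nonneg fun j _ => Finset.sum_nonneg fun w _ =>
            mul_nonneg (mul_nonneg (stG_nonneg f hf _ _) (hc _).le) (hc _).le
        rcases hnn.eq_or_lt with h0 | h0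
        · have hall : ∀ j w, stG z f (S.erase i.1) j w = 0 := by
            intro j w
            have hn1 : ∀ j w, 0 ≤ stG z f (S.erase i.1) j w * h j * h (stP z (S.erase i.1) j w) :=
              fun j w => mul_nonneg (mul_nonneg (stG_nonneg f hf _ _) (hc _).le) (hc _).le
            have a1 := (Finset.sum_eq_zero_iff_of_nonneg
              (fun j _ => Finset.sum_nonneg fun w _ => hn1 j w)).1 h0.symm j (Finset.mem_univ j)
            have a2 := (Finset.sum_eq_zero_iff_of_nonneg
              (fun w _ => hn1 j w)).1 a1 w (Finset.mem_univ w)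
            rcases mul_eq_zero.1 a2 with a3 | a3
            · rcases mul_eq_zero.1 a3 with a4 | a4
              · exact a4
              · exact absurd a4 (hc _).ne'
            · exact absurd a3 (hc _).ne'
          simp [stB, hall]
        · have := hyp i hi (fun j => v (stP z S i j)) h h0
          rw [le_div_iff₀ h0, mul_assoc]
          exact mul_le_mul_of_nonneg_left this (hc _).le
      · simp [stB_zero_row, hi])
  have main' : ∀ v, stB z f' S v h = 0 → stB z f' S v v ≤ 0 := by
    intro v hv
    rw [← hMB]
    apply main
    rw [← hv, ← hMB]
    refine Finset.sum_congr rfl fun i _ => ?_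
    rw [Finset.sum_mul]
    refine Finset.sum_congr rfl fun j _ => ?_
    ring
  intro v w hw
  have hwh : stB z f' S w h ≠ 0 := fun h0 => absurd (main' w h0) (not_le.2 hw)
  set s := stB z f' S v h / stB z f' S w h with hs
  have h1 := main' (fun i => v i - s * w i) (by
    rw [stB_sub_smul, hs]; field_simp; ring)
  rw [stB_sub_smul, stB_symm, stB_sub_smul, stB_symm (g := w) (k := fun i => v i - s * w i),
    stB_sub_smul, stB_symm (g := w) (k := v)] at h1
  nlinarith [sq_nonneg (stB z f' S v w - s * stB z f' S w w)]

end StanleyCombinatorics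


section StanleyCombinatorics2
open Classical

noncomputable def stF {P : Type*} [Fintype P] [PartialOrder P] (z : P) :
    ℕ → ℕ → Finset P → ℝ
  | 0, 0, S => if S = ∅ then 1 else 0
  | 0, b + 1, S => ∑ x, if stD z S (x, true) then stF z 0 b (S.erase x) else 0
  | a + 1, b, S => ∑ x, if stD z S (x, false) then stF z a b (S.erase x) else 0

noncomputable def stK {P : Type*} [PartialOrder P] (z : P) (β : Bool) (R : Finset P) : ℕ :=
  (R.filter (fun x => stR β x z)).card

variable {P : Type*} [PartialOrder P] {z : P} {S : Finset P} {i j w : P × Bool}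

lemma stR_not (β : Bool) (x y : P) : stR (!β) x y ↔ stR β y x := by
  cases β <;> simp [stR]

lemma stR_asymm {β : Bool} {x y : P} (h : stR β x y) : ¬ stR β y x := by
  cases β <;> exact lt_asymm h

lemma stR_trans {β : Bool} {x y u : P} (h : stR β x y) (h' : stR β y u) : stR β x u := by
  cases β
  · exact lt_trans h h'
  · exact lt_trans h' h

lemma stK_erase_le (β : Bool) (x : P) : stK z β (S.erase x) ≤ stK z β S :=
  Finset.card_le_card (Finset.filter_subset_filter _ (Finset.erase_subset _ _))

lemma stK_erase_of_not (β : Bool) {x : P} (h : ¬ stR β x z) : stK z β (S.erase x) = stK z β S := by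
  unfold stK
  congr 1
  ext u
  simp only [Finset.mem_filter, Finset.mem_erase]
  constructor
  · rintro ⟨⟨_, h1⟩, h2⟩; exact ⟨h1, h2⟩
  · rintro ⟨h1, h2⟩; exact ⟨⟨fun e => h (e ▸ h2), h1⟩, h2⟩

lemma stK_erase_of (β : Bool) {x : P} (hx : x ∈ S) (h : stR β x z) :
    stK z β (S.erase x) + 1 = stK z β S := by
  unfold stK
  rw [Finset.filter_erase]
  exact Finset.card_erase_add_one (Finset.mem_filter.2 ⟨hx, h⟩)

lemma stK_le_erase (β : Bool) (x : P) : stK z β S ≤ stK z β (S.erase x) + 1 := by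
  by_cases h : stR β x z
  · by_cases hx : x ∈ S
    · exact (stK_erase_of β hx h).ge
    · rw [Finset.erase_eq_of_notMem hx]; omega
  · rw [stK_erase_of_not β h]; omega

lemma stK_add (β : Bool) : stK z β S + stK z (!β) S ≤ S.card := by
  unfold stK
  rw [← Finset.card_union_of_disjoint]
  · exact Finset.card_le_card (Finset.union_subset (Finset.filter_subset _ _)
      (Finset.filter_subset _ _))
  · rw [Finset.disjoint_filter]
    intro x _ h1 h2
    exact stR_asymm h1 ((stR_not _ _ _).1 h2)

lemma stD_exists (β : Bool) {x : P} (hx : x ∈ S) (h : ¬ stR β z x) :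
    ∃ y, stD z S (y, β) ∧ (y = x ∨ stR β y x) := by
  have key : ∃ y ∈ S, (y = x ∨ stR β y x) ∧ ∀ u ∈ S, ¬ stR β u y := by
    cases β
    · obtain ⟨y, hy, hm⟩ := Finset.exists_le_minimal S hx
      exact ⟨y, hm.1, hy.eq_or_lt, fun u hu hlt => absurd (hm.2 hu (le_of_lt hlt)) (not_le_of_gt hlt)⟩
    · obtain ⟨y, hy, hm⟩ := Finset.exists_le_maximal S hx
      exact ⟨y, hm.1, hy.eq_or_lt.imp Eq.symm id,
        fun u hu hlt => absurd (hm.2 hu (le_of_lt hlt)) (not_le_of_gt hlt)⟩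
  obtain ⟨y, hy, h1, h2⟩ := key
  refine ⟨y, ⟨hy, ?_, h2⟩, h1⟩
  intro hz
  rcases h1 with rfl | h1
  · exact h hz
  · exact h (stR_trans hz h1)

lemma stD_exists_K (β : Bool) (h : 0 < stK z β S) : ∃ y, stD z S (y, β) ∧ stR β y z := by
  obtain ⟨x, hx⟩ := Finset.card_pos.1 h
  rw [Finset.mem_filter] at hx
  obtain ⟨y, hy, h1⟩ := stD_exists β hx.1 (stR_asymm hx.2)
  refine ⟨y, hy, ?_⟩
  rcases h1 with rfl | h1
  · exact hx.2
  · exact stR_trans h1 hx.2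

lemma stD_exists_rem (β : Bool) (n : ℕ) (h : stK z β S ≤ n + 1) (h2 : stK z (!β) S < S.card) :
    ∃ y, stD z S (y, β) ∧ stK z β (S.erase y) ≤ n ∧ stK z (!β) (S.erase y) = stK z (!β) S := by
  have fin : ∀ y, stD z S (y, β) → stK z (!β) (S.erase y) = stK z (!β) S := fun y hy =>
    stK_erase_of_not _ (fun h => hy.2.1 ((stR_not _ _ _).1 h))
  by_cases h0 : 0 < stK z β S
  · obtain ⟨y, hy, h1⟩ := stD_exists_K β h0
    refine ⟨y, hy, ?_, fin y hy⟩
    have := stK_erase_of β hy.1 h1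
    simp only at this
    omega
  · obtain ⟨x, hx, hx2⟩ : ∃ x ∈ S, ¬ stR (!β) x z := by
      by_contra hcon
      push Not at hcon
      have : stK z (!β) S = S.card := by
        unfold stK; rw [Finset.filter_true_of_mem hcon]
      omega
    obtain ⟨y, hy, _⟩ := stD_exists β hx (fun h => hx2 ((stR_not _ _ _).2 h))
    refine ⟨y, hy, ?_, fin y hy⟩
    have := stK_erase_le (z := z) (S := S) β y
    omega

lemma stD_nonempty (h : S.Nonempty) : ∃ i, stD z S i := by
  obtain ⟨x, hx⟩ := h
  by_cases h1 : stR false z x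
  · obtain ⟨y, hy, _⟩ := stD_exists true hx (stR_asymm (β := true) (x := x) (y := z) h1)
    exact ⟨_, hy⟩
  · obtain ⟨y, hy, _⟩ := stD_exists false hx h1
    exact ⟨_, hy⟩

variable [Fintype P]

lemma stF_nonneg (a b : ℕ) (S : Finset P) : 0 ≤ stF z a b S := by
  induction a generalizing S with
  | zero =>
    induction b generalizing S with
    | zero => rw [stF]; split_ifs <;> norm_num
    | succ b ih =>
      rw [stF]; refine Finset.sum_nonneg fun x _ => ?_
      split_ifs
      · exact ih _
      · exact le_rfl
  | succ a ih =>
    rw [stF]; refine Finset.sum_nonneg fun x _ => ?_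
    split_ifs
    · exact ih _
    · exact le_rfl

lemma stF_bot (a b : ℕ) (S : Finset P) :
    stF z (a + 1) b S = ∑ x, if stD z S (x, false) then stF z a b (S.erase x) else 0 := by
  rw [stF]

lemma stD_comm (x y : P) : (stD z S (x, false) ∧ stD z (S.erase x) (y, true)) ↔
    (stD z S (y, true) ∧ stD z (S.erase y) (x, false)) := by
  constructor
  · rintro ⟨h1, h2⟩
    by_cases h : stD z S (y, true)
    · exact ⟨h, stD_erase h1 (stD_ne h2).symm⟩
    · exact absurd (stD_side (i := (x, false)) h1 h2 h) (by simp)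
  · rintro ⟨h1, h2⟩
    by_cases h : stD z S (x, false)
    · exact ⟨h, stD_erase h1 (stD_ne h2).symm⟩
    · exact absurd (stD_side (i := (y, true)) h1 h2 h) (by simp)

lemma stF_top (a b : ℕ) (S : Finset P) :
    stF z a (b + 1) S = ∑ x, if stD z S (x, true) then stF z a b (S.erase x) else 0 := by
  induction a generalizing S with
  | zero => rw [stF]
  | succ a ih =>
    rw [stF_bot]
    simp only [ih, stF_bot]
    have e1 : ∀ x, (if stD z S (x, false) then ∑ y, (if stD z (S.erase x) (y, true) then
        stF z a b ((S.erase x).erase y) else 0) else 0) =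
        ∑ y, if stD z S (x, false) ∧ stD z (S.erase x) (y, true) then
          stF z a b ((S.erase x).erase y) else 0 := by
      intro x
      by_cases h : stD z S (x, false) <;> simp [h]
    have e2 : ∀ y, (if stD z S (y, true) then ∑ x, (if stD z (S.erase y) (x, false) then
        stF z a b ((S.erase y).erase x) else 0) else 0) =
        ∑ x, if stD z S (y, true) ∧ stD z (S.erase y) (x, false) then
          stF z a b ((S.erase y).erase x) else 0 := by
      intro y
      by_cases h : stD z S (y, true) <;> simp [h]
    simp only [e1, e2]
    rw [Finset.sum_comm]
    refine Finset.sum_congr rfl fun y _ => Finset.sum_congr rfl fun x _ => ?_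
    rw [Finset.erase_right_comm]
    simp only [stD_comm x y]

lemma stF_pos (a b : ℕ) (S : Finset P) (h : S.card = a + b) (ha : stK z false S ≤ a)
    (hb : stK z true S ≤ b) : 0 < stF z a b S := by
  have aux : ∀ (β : Bool) (x : P) (g : Finset P → ℝ), (∀ R, 0 ≤ g R) → stD z S (x, β) →
      0 < g (S.erase x) → 0 < ∑ x, if stD z S (x, β) then g (S.erase x) else 0 := by
    intro β x g hg hx h0
    refine Finset.sum_pos' (fun y _ => ?_) ⟨x, Finset.mem_univ _, ?_⟩
    · split_ifs
      · exact hg _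
      · exact le_rfl
    · rw [if_pos hx]; exact h0
  induction a generalizing S with
  | zero =>
    induction b generalizing S with
    | zero =>
      have : S = ∅ := Finset.card_eq_zero.1 (by omega)
      rw [stF, if_pos this]; norm_num
    | succ b ih =>
      obtain ⟨x, hx, h1, h2⟩ := stD_exists_rem (z := z) (S := S) true b hb (by simp; omega)
      rw [stF]
      refine aux true x _ (stF_nonneg _ _) hx (ih _ ?_ ?_ h1 ?_)
      · rw [Finset.card_erase_of_mem hx.1]; omega
      · simp at h2; omega
      · intro β x g hg hx h0
        refine Finset.sum_pos' (fun y _ => ?_) ⟨x, Finset.mem_univ _, ?_⟩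
        · split_ifs
          · exact hg _
          · exact le_rfl
        · rw [if_pos hx]; exact h0
  | succ a ih =>
    obtain ⟨x, hx, h1, h2⟩ := stD_exists_rem (z := z) (S := S) false a ha (by simp; omega)
    rw [stF_bot]
    refine aux false x _ (stF_nonneg _ _) hx (ih _ ?_ h1 ?_ ?_)
    · rw [Finset.card_erase_of_mem hx.1]; omega
    · simp at h2; omega
    · intro β x g hg hx h0
      refine Finset.sum_pos' (fun y _ => ?_) ⟨x, Finset.mem_univ _, ?_⟩
      · split_ifs
        · exact hg _
        · exact le_rfl
      · rw [if_pos hx]; exact h0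

lemma stF_supp (a b : ℕ) (S : Finset P) (h : stF z a b S ≠ 0) :
    stK z false S ≤ a ∧ stK z true S ≤ b := by
  induction a generalizing S with
  | zero =>
    induction b generalizing S with
    | zero =>
      rw [stF] at h
      have : S = ∅ := by by_contra h'; simp [h'] at h
      subst this; simp [stK]
    | succ b ih =>
      rw [stF] at h
      obtain ⟨x, _, hx⟩ := Finset.exists_ne_zero_of_sum_ne_zero h
      by_cases hd : stD z S (x, true)
      · rw [if_pos hd] at hx
        obtain ⟨h1, h2⟩ := ih _ hx
        have e1 := stK_le_erase (z := z) (S := S) true x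
        have e2 := stK_erase_of_not (z := z) (S := S) false (x := x) hd.2.1
        omega
      · simp [hd] at hx
  | succ a ih =>
    rw [stF_bot] at h
    obtain ⟨x, _, hx⟩ := Finset.exists_ne_zero_of_sum_ne_zero h
    by_cases hd : stD z S (x, false)
    · rw [if_pos hd] at hx
      obtain ⟨h1, h2⟩ := ih _ hx
      have e1 := stK_le_erase (z := z) (S := S) false x
      have e2 := stK_erase_of_not (z := z) (S := S) true (x := x) hd.2.1
      omega
    · simp [hd] at hx

lemma stL_F (c : Bool → ℝ) (a b : ℕ) (R : Finset P) :
    stL z c (stF z a b) R = c false * stF z (a + 1) b R + c true * stF z a (b + 1) R := by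
  unfold stL
  rw [Fintype.sum_prod_type, stF_bot, stF_top, Finset.mul_sum, Finset.mul_sum,
    ← Finset.sum_add_distrib]
  refine Finset.sum_congr rfl fun x _ => ?_
  rw [Fintype.sum_bool]
  split_ifs <;> simp [add_comm]

lemma stL_pos (c : Bool → ℝ) (hc : ∀ β, 0 < c β) (a b : ℕ) (R : Finset P)
    (h : R.card = a + b + 1) (ha : stK z false R ≤ a + 1) (hb : stK z true R ≤ b + 1) :
    0 < stL z c (stF z a b) R := by
  rw [stL_F]
  have h1 := stF_nonneg (z := z) (a + 1) b R
  have h2 := stF_nonneg (z := z) a (b + 1) R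
  have h3 := hc false
  have h4 := hc true
  have := stK_add (z := z) (S := R) false
  simp only [Bool.not_false] at this
  by_cases h5 : stK z true R ≤ b
  · have := stF_pos (z := z) (a + 1) b R (by omega) ha h5
    positivity
  · have := stF_pos (z := z) a (b + 1) R (by omega) (by omega) hb
    positivity

lemma stL_supp (c : Bool → ℝ) (a b : ℕ) (R : Finset P)
    (h : 0 < stL z c (stF z a b) R) : stK z false R ≤ a + 1 ∧ stK z true R ≤ b + 1 := by
  rw [stL_F] at h
  by_cases h1 : stF z (a + 1) b R = 0
  · by_cases h2 : stF z a (b + 1) R = 0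
    · simp [h1, h2] at h
    · have := stF_supp _ _ _ h2; omega
  · have := stF_supp _ _ _ h1; omega

lemma st_conn (c : Bool → ℝ) (hc : ∀ β, 0 < c β) (a b : ℕ) (hS : S.card = a + b + 3)
    (v : P × Bool → ℝ) (hv : ∀ i j, stD z S i → stD z S j → i.1 ≠ j.1 →
        0 < stL z c (stF z a b) ((S.erase i.1).erase j.1) → v i = v j) (i j : P × Bool)
    (hi : ∃ i', stD z S i ∧ stD z (S.erase i.1) i' ∧
          0 < stL z c (stF z a b) ((S.erase i.1).erase i'.1))
    (hj : ∃ j', stD z S j ∧ stD z (S.erase j.1) j' ∧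
          0 < stL z c (stF z a b) ((S.erase j.1).erase j'.1)) : v i = v j := by
  let n : Bool → ℕ := fun β => match β with | false => a | true => b
  have hsum : ∀ β, n β + n (!β) = a + b := by intro β; cases β <;> simp [n]; omega
  have hpos : ∀ (β : Bool) (R : Finset P), R.card = a + b + 1 → stK z β R ≤ n β + 1 →
      stK z (!β) R ≤ n (!β) + 1 → 0 < stL z c (stF z a b) R := by
    intro β R h1 h2 h3
    cases β
    · exact stL_pos c hc a b R h1 h2 h3
    · exact stL_pos c hc a b R h1 h3 h2
  have hsupp : ∀ (β : Bool) (R : Finset P), 0 < stL z c (stF z a b) R →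
      stK z β R ≤ n β + 1 := by
    intro β R h
    have := stL_supp c a b R h
    cases β
    · exact this.1
    · exact this.2
  have hcard : ∀ x ∈ S, ∀ y ∈ S, x ≠ y → ((S.erase x).erase y).card = a + b + 1 := by
    intro x hx y hy hxy
    rw [Finset.card_erase_of_mem (Finset.mem_erase.2 ⟨hxy.symm, hy⟩), Finset.card_erase_of_mem hx]
    omega
  by_cases hβ : ∃ β, n β + 2 ≤ stK z β S
  · obtain ⟨β, hβ⟩ := hβ
    obtain ⟨y, hy, hyz⟩ := stD_exists_K (z := z) (S := S) β (by omega)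
    have main : ∀ i, (∃ i', stD z S i ∧ stD z (S.erase i.1) i' ∧
          0 < stL z c (stF z a b) ((S.erase i.1).erase i'.1)) → v i = v (y, β) := by
      rintro i ⟨i', h1, h2, h3⟩
      by_cases hiy : i.1 = y
      · congr 1
        refine Prod.ext hiy ?_
        by_contra hne
        have : i.2 = !β := by
          revert hne; cases i.2 <;> cases β <;> simp
        have h4 := h1.2.1
        rw [this, hiy, stR_not] at h4
        exact h4 hyz
      · refine hv i (y, β) h1 hy hiy (hpos β _ (hcard _ h1.1 _ hy.1 hiy) ?_ ?_)
        · have e1 := hsupp β _ h3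
          have e2 := stK_le_erase (z := z) (S := S.erase i.1) β i'.1
          have e3 := stK_erase_of (z := z) (S := S.erase i.1) β (x := y)
            (Finset.mem_erase.2 ⟨Ne.symm hiy, hy.1⟩) hyz
          simp only
          omega
        · have e1 := stK_erase_le (z := z) (S := S.erase i.1) (!β) y
          have e2 := stK_erase_le (z := z) (S := S) (!β) i.1
          have e3 := stK_add (z := z) (S := S) β
          have e4 := hsum β
          simp only
          omega
    rw [main i hi, main j hj]
  · push Not at hβ
    have main : ∀ i j, stD z S i → stD z S j → i.1 ≠ j.1 → v i = v j := by
      intro i j hi hj hij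
      refine hv i j hi hj hij (hpos false _ (hcard _ hi.1 _ hj.1 hij) ?_ ?_)
      · have e1 := stK_erase_le (z := z) (S := S.erase i.1) false j.1
        have e2 := stK_erase_le (z := z) (S := S) false i.1
        have := hβ false
        omega
      · have e1 := stK_erase_le (z := z) (S := S.erase i.1) true j.1
        have e2 := stK_erase_le (z := z) (S := S) true i.1
        have := hβ true
        simp only [Bool.not_false]
        omega
    obtain ⟨_, hi, _⟩ := hi
    obtain ⟨_, hj, _⟩ := hj
    by_cases hij : i.1 = j.1
    · by_cases hij2 : i.2 = j.2
      · rw [Prod.ext hij hij2]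
      · obtain ⟨d, hd⟩ := stD_nonempty (z := z) (S := S.erase i.1) (by
          rw [← Finset.card_pos, Finset.card_erase_of_mem hi.1]; omega)
        have hdS : stD z S d := by
          by_contra hn
          have e1 := stD_side hi hd hn
          have e2 := stD_side hj (by rwa [← hij]) hn
          exact hij2 (e1.trans e2.symm)
        have hne := stD_ne hd
        rw [main i d hi hdS (Ne.symm hne), main d j hdS hj (by rwa [← hij])]
    · exact main i j hi hj hij

lemma st_lim (p q r p' q' r' : ℝ) (H : ∀ t : ℝ, 0 < t → t < 1 → 0 < t * q + (1 - t) * q' →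
    (t * p + (1 - t) * p') * (t * q + (1 - t) * q') ≤ (t * r + (1 - t) * r') ^ 2) (hq : 0 < q) :
    p * q ≤ r ^ 2 := by
  have c0 : Filter.Tendsto (fun t : ℝ => t * q + (1 - t) * q') (nhdsWithin 1 (Set.Iio 1)) (nhds q) := by
    have : Continuous (fun t : ℝ => t * q + (1 - t) * q') := by fun_prop
    have := (this.tendsto 1).mono_left (nhdsWithin_le_nhds (s := Set.Iio 1))
    simpa using this
  have c1 : Filter.Tendsto (fun t : ℝ => (t * p + (1 - t) * p') * (t * q + (1 - t) * q'))
      (nhdsWithin 1 (Set.Iio 1)) (nhds (p * q)) := by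
    have : Continuous (fun t : ℝ => (t * p + (1 - t) * p') * (t * q + (1 - t) * q')) := by fun_prop
    have := (this.tendsto 1).mono_left (nhdsWithin_le_nhds (s := Set.Iio 1))
    simpa using this
  have c2 : Filter.Tendsto (fun t : ℝ => (t * r + (1 - t) * r') ^ 2)
      (nhdsWithin 1 (Set.Iio 1)) (nhds (r ^ 2)) := by
    have : Continuous (fun t : ℝ => (t * r + (1 - t) * r') ^ 2) := by fun_prop
    have := (this.tendsto 1).mono_left (nhdsWithin_le_nhds (s := Set.Iio 1))
    simpa using this
  refine le_of_tendsto_of_tendsto c1 c2 ?_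
  have e1 : ∀ᶠ t : ℝ in nhdsWithin 1 (Set.Iio 1), 0 < t :=
    nhdsWithin_le_nhds (lt_mem_nhds one_pos)
  filter_upwards [c0.eventually (lt_mem_nhds hq), e1, self_mem_nhdsWithin] with t h1 h2 h3
  exact H t h2 h3 h1

lemma stB_stL (c : Bool → ℝ) (a b : ℕ) (g k : P × Bool → ℝ) :
    stB z (stL z c (stF z a b)) S g k = c false * stB z (stF z (a + 1) b) S g k +
      c true * stB z (stF z a (b + 1)) S g k := by
  unfold stB
  simp only [Finset.mul_sum, ← Finset.sum_add_distrib]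
  refine Finset.sum_congr rfl fun i _ => Finset.sum_congr rfl fun j _ => ?_
  unfold stG
  split_ifs
  · rw [stL_F]; ring
  · ring

lemma st_sum_pair {x y : P} (hxy : x ≠ y) (φ : P × Bool → ℝ)
    (h : ∀ i, i.1 ≠ x → i.1 ≠ y → φ i = 0) :
    ∑ i, φ i = φ (x, false) + φ (x, true) + φ (y, false) + φ (y, true) := by
  rw [Fintype.sum_prod_type]
  rw [← Finset.sum_subset (Finset.subset_univ {x, y})]
  · rw [Finset.sum_pair hxy, Fintype.sum_bool, Fintype.sum_bool]; ring
  · intro u _ hu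
    simp only [Finset.mem_insert, Finset.mem_singleton, not_or] at hu
    exact Finset.sum_eq_zero fun β _ => h (u, β) hu.1 hu.2

lemma st_sum_single {y : P} (φ : P × Bool → ℝ)
    (h : ∀ i, i.1 ≠ y → φ i = 0) :
    ∑ i, φ i = φ (y, false) + φ (y, true) := by
  rw [Fintype.sum_prod_type, Finset.sum_eq_single y, Fintype.sum_bool]
  · ring
  · intro u _ hu
    exact Finset.sum_eq_zero fun β _ => h (u, β) hu
  · intro h; exact absurd (Finset.mem_univ _) h

lemma stB_base {x y : P} (hxy : x ≠ y) (hS : S = {x, y}) (g k : P × Bool → ℝ) :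
    stB z (stF z 0 0) S g k =
      (if ¬ z < x ∧ ¬ y < x then g (x, false) * (
        (if ¬ z < y then k (stP z S (x, false) (y, false)) else 0) +
        (if ¬ y < z then k (stP z S (x, false) (y, true)) else 0)) else 0) +
      (if ¬ x < z ∧ ¬ x < y then g (x, true) * (
        (if ¬ z < y then k (stP z S (x, true) (y, false)) else 0) +
        (if ¬ y < z then k (stP z S (x, true) (y, true)) else 0)) else 0) +
      (if ¬ z < y ∧ ¬ x < y then g (y, false) * (
        (if ¬ z < x then k (stP z S (y, false) (x, false)) else 0) +
        (if ¬ x < z then k (stP z S (y, false) (x, true)) else 0)) else 0) +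
      (if ¬ y < z ∧ ¬ y < x then g (y, true) * (
        (if ¬ z < x then k (stP z S (y, true) (x, false)) else 0) +
        (if ¬ x < z then k (stP z S (y, true) (x, true)) else 0)) else 0) := by
  have hex : S.erase x = {y} := by
    subst hS; ext u; simp only [Finset.mem_erase, Finset.mem_insert, Finset.mem_singleton]
    constructor
    · rintro ⟨h1, h2 | h2⟩
      · exact absurd h2 h1
      · exact h2
    · rintro rfl; exact ⟨hxy.symm, Or.inr rfl⟩
  have hey : S.erase y = {x} := by
    subst hS; ext u; simp only [Finset.mem_erase, Finset.mem_insert, Finset.mem_singleton]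
    constructor
    · rintro ⟨h1, h2 | h2⟩
      · exact h2
      · exact absurd h2 h1
    · rintro rfl; exact ⟨hxy, Or.inl rfl⟩
  unfold stB
  rw [st_sum_pair hxy]
  · rw [st_sum_single (y := y), st_sum_single (y := y), st_sum_single (y := x),
      st_sum_single (y := x)]
    · simp only [stG, hex, hey, Finset.erase_singleton]
      have h0 : stF z 0 0 (∅ : Finset P) = 1 := by rw [stF]; simp
      have d1 : stD z S (x, false) ↔ ¬ z < x ∧ ¬ y < x := by subst hS; simp [stD, stR]
      have d2 : stD z S (x, true) ↔ ¬ x < z ∧ ¬ x < y := by subst hS; simp [stD, stR]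
      have d3 : stD z S (y, false) ↔ ¬ z < y ∧ ¬ x < y := by subst hS; simp [stD, stR]
      have d4 : stD z S (y, true) ↔ ¬ y < z ∧ ¬ y < x := by subst hS; simp [stD, stR]
      have s1 : ∀ u : P, stD z {u} (u, false) ↔ ¬ z < u := by intro u; simp [stD, stR]
      have s2 : ∀ u : P, stD z {u} (u, true) ↔ ¬ u < z := by intro u; simp [stD, stR]
      simp only [h0, s1, s2, d1, d2, d3, d4]
      congr 1
      · congr 1
        · congr 1
          · by_cases h : ¬ z < x ∧ ¬ y < x
            · simp only [h, true_and, not_false_eq_true, and_self, if_true]; split_ifs <;> ring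
            · simp [h]
          · by_cases h : ¬ x < z ∧ ¬ x < y
            · simp only [h, true_and, not_false_eq_true, and_self, if_true]; split_ifs <;> ring
            · simp [h]
        · by_cases h : ¬ z < y ∧ ¬ x < y
          · simp only [h, true_and, not_false_eq_true, and_self, if_true]; split_ifs <;> ring
          · simp [h]
      · by_cases h : ¬ y < z ∧ ¬ y < x
        · simp only [h, true_and, not_false_eq_true, and_self, if_true]; split_ifs <;> ring
        · simp [h]
    all_goals
      intro i hi
      simp only [stG, hex, hey]
      rw [if_neg, zero_mul, zero_mul]
      rintro ⟨_, h⟩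
      exact hi (Finset.mem_singleton.1 h.1)
  · intro i hi hi'
    refine Finset.sum_eq_zero fun j _ => ?_
    rw [stB_zero_row, zero_mul, zero_mul]
    intro h
    have := h.1
    rw [hS] at this
    simp [hi, hi'] at this

lemma st_base_lt {x y : P} (hxy : x < y) (hS : S = {x, y}) : stHyp z (stF z 0 0) S := by
  have d1 : stD z S (x, false) ↔ ¬ z < x := by subst hS; simp [stD, stR, hxy.not_gt]
  have d2 : ¬ stD z S (x, true) := by subst hS; simp [stD, stR, hxy]
  have d3 : ¬ stD z S (y, false) := by subst hS; simp [stD, stR, hxy]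
  have d4 : stD z S (y, true) ↔ ¬ y < z := by subst hS; simp [stD, stR, hxy.not_gt]
  intro v w _
  simp only [stB_base hxy.ne hS, stP, d1, d2, d3, d4, hxy, hxy.not_gt, not_true_eq_false,
    and_false, if_false, not_false_eq_true, and_true]
  by_cases h1 : z < x
  · have h2 : z < y := h1.trans hxy
    simp only [h1, h2, h1.not_gt, h2.not_gt, not_true_eq_false, not_false_eq_true, if_true,
      if_false]
    apply le_of_eq; ring
  by_cases h2 : y < z
  · have h3 : x < z := hxy.trans h2
    simp only [h1, h2, h3, h2.not_gt, not_true_eq_false, not_false_eq_true, if_true,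
      if_false]
    apply le_of_eq; ring
  simp only [h1, h2, not_false_eq_true, if_true]
  split_ifs <;> nlinarith [sq_nonneg (v (x, false) * w (y, true) - v (y, true) * w (x, false))]

lemma st_base_inc {x y : P} (hne : x ≠ y) (hxy : ¬ x < y) (hyx : ¬ y < x) (hS : S = {x, y}) :
    stHyp z (stF z 0 0) S := by
  have d1 : stD z S (x, false) ↔ ¬ z < x := by subst hS; simp [stD, stR, hyx]
  have d2 : stD z S (x, true) ↔ ¬ x < z := by subst hS; simp [stD, stR, hxy]
  have d3 : stD z S (y, false) ↔ ¬ z < y := by subst hS; simp [stD, stR, hxy]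
  have d4 : stD z S (y, true) ↔ ¬ y < z := by subst hS; simp [stD, stR, hyx]
  have key : ∀ g k : P × Bool → ℝ, stB z (stF z 0 0) S g k =
    ((if ¬ z < x then g (x, false) else 0) + (if ¬ x < z then g (x, true) else 0)) *
    ((if ¬ z < y then k (y, false) else 0) + (if ¬ y < z then k (y, true) else 0)) +
    ((if ¬ z < y then g (y, false) else 0) + (if ¬ y < z then g (y, true) else 0)) *
    ((if ¬ z < x then k (x, false) else 0) + (if ¬ x < z then k (x, true) else 0)) := by
    intro g k
    rw [stB_base hne hS]
    simp only [stP, d1, d2, d3, d4, hxy, hyx, not_false_eq_true, and_true]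
    split_ifs <;> ring
  intro v w _
  simp only [key]
  generalize ((if ¬ z < x then v (x, false) else 0) + (if ¬ x < z then v (x, true) else 0)) = A
  generalize ((if ¬ z < x then w (x, false) else 0) + (if ¬ x < z then w (x, true) else 0)) = A'
  generalize ((if ¬ z < y then v (y, false) else 0) + (if ¬ y < z then v (y, true) else 0)) = B
  generalize ((if ¬ z < y then w (y, false) else 0) + (if ¬ y < z then w (y, true) else 0)) = B'
  nlinarith [sq_nonneg (A * B' - B * A')]

lemma st_base (hS : S.card = 2) : stHyp z (stF z 0 0) S := by
  obtain ⟨x, y, hne, rfl⟩ := Finset.card_eq_two.1 hS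
  by_cases h1 : x < y
  · exact st_base_lt h1 rfl
  by_cases h2 : y < x
  · exact st_base_lt h2 (Finset.pair_comm x y)
  exact st_base_inc hne h1 h2 rfl

lemma st_main (n : ℕ) : ∀ (a b : ℕ) (S : Finset P), a + b = n → S.card = n + 2 →
    stHyp z (stF z a b) S := by
  induction n with
  | zero =>
    intro a b S h hS
    obtain ⟨rfl, rfl⟩ : a = 0 ∧ b = 0 := by omega
    exact st_base hS
  | succ n ih =>
    intro a b S h hS
    have key : ∀ a b, a + b = n → ∀ t : ℝ, 0 < t → t < 1 → ∀ v w : P × Bool → ℝ,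
        0 < t * stB z (stF z (a + 1) b) S w w + (1 - t) * stB z (stF z a (b + 1)) S w w →
        (t * stB z (stF z (a + 1) b) S v v + (1 - t) * stB z (stF z a (b + 1)) S v v) *
        (t * stB z (stF z (a + 1) b) S w w + (1 - t) * stB z (stF z a (b + 1)) S w w) ≤
        (t * stB z (stF z (a + 1) b) S v w + (1 - t) * stB z (stF z a (b + 1)) S v w) ^ 2 := by
      intro a b hab t ht0 ht1 v w hw
      let c : Bool → ℝ := fun β => match β with | false => t | true => 1 - t
      have hc : ∀ β, 0 < c β := by intro β; cases β <;> simp [c, ht0, ht1]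
      have := st_step (z := z) (S := S) c hc (stF z a b) (stF_nonneg a b)
        (fun i hi => ih a b _ hab (by rw [Finset.card_erase_of_mem hi.1]; omega))
        (fun v hv i j hi hj => st_conn c hc a b (by omega) v hv i j hi hj)
      have := this v w
      simp only [stB_stL] at this
      exact this hw
    intro v w hw
    cases a with
    | succ a => exact st_lim _ _ _ _ _ _ (fun t h0 h1 h2 => key a b (by omega) t h0 h1 v w h2) hw
    | zero =>
      cases b with
      | zero => omega
      | succ b =>
        refine st_lim _ _ _ (stB z (stF z 1 b) S v v) (stB z (stF z 1 b) S w w)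
          (stB z (stF z 1 b) S v w) (fun t h0 h1 h2 => ?_) hw
        have := key 0 b (by omega) (1 - t) (by linarith) (by linarith) v w
        simp only [sub_sub_cancel, zero_add] at this
        have h3 := this (by linarith)
        convert h3 using 1
        · ring
        · ring

lemma stB_ind (a b : ℕ) (β β' : Bool) (S : Finset P) :
    stB z (stF z a b) S (fun i => if i.2 = β then 1 else 0) (fun i => if i.2 = β' then 1 else 0) =
    ∑ x, if stD z S (x, β) then (∑ y, if stD z (S.erase x) (y, β') then
      stF z a b ((S.erase x).erase y) else 0) else 0 := by
  unfold stB
  rw [Fintype.sum_prod_type]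
  refine Finset.sum_congr rfl fun x _ => ?_
  rw [Finset.sum_eq_single β]
  · by_cases hx : stD z S (x, β)
    · rw [if_pos hx, Fintype.sum_prod_type]
      refine Finset.sum_congr rfl fun y _ => ?_
      have : ∀ β'', stG z (stF z a b) S (x, β) (y, β'') * (if β = β then (1:ℝ) else 0) *
          (if (stP z S (x, β) (y, β'')).2 = β' then 1 else 0) =
          stG z (stF z a b) S (x, β) (y, β'') * (if β'' = β' then 1 else 0) := by
        intro β''
        by_cases hy : stD z (S.erase x) (y, β'')
        · rw [stP_side hx hy]; simp
        · simp [stG, hy]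
      rw [Finset.sum_congr rfl (fun β'' _ => this β''), Finset.sum_eq_single β']
      · simp [stG, hx]
      · intro b _ hb; simp [hb]
      · intro h; exact absurd (Finset.mem_univ _) h
    · simp [hx, stG]
  · intro b _ hb; simp [hb]
  · intro h; exact absurd (Finset.mem_univ _) h

lemma stF_logconcave (a b : ℕ) (S : Finset P) (hS : S.card = a + b + 2) :
    stF z a (b + 2) S * stF z (a + 2) b S ≤ (stF z (a + 1) (b + 1) S) ^ 2 := by
  have h1 := stB_ind (z := z) a b false false S
  have h2 := stB_ind (z := z) a b false true S
  have h3 := stB_ind (z := z) a b true true S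
  simp only [← stF_bot, ← stF_top] at h1 h2 h3
  rcases (stF_nonneg (z := z) a (b + 2) S).eq_or_lt with h0 | h0
  · rw [← h0, zero_mul]; positivity
  · have := st_main (z := z) (a + b) a b S rfl hS (fun i => if i.2 = false then 1 else 0)
      (fun i => if i.2 = true then 1 else 0) (by rw [h3]; exact h0)
    rw [h1, h2, h3] at this
    linarith

end StanleyCombinatorics2


section StanleyCombinatorics3
open Classical

/-- order-preserving labelings of `S` by `V`, with `z` having label `p`. -/
def stE {P : Type*} [PartialOrder P] (z : P) (S : Finset P) (V : Finset ℕ) (p : ℕ) :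
    Set (P → ℕ) :=
  {f | (∀ x, x ∉ S → f x = p) ∧ Set.BijOn f S V ∧
    (∀ u ∈ S, ∀ w ∈ S, u < w → f u < f w) ∧ (∀ u ∈ S, u < z → f u < p) ∧
    (∀ u ∈ S, z < u → p < f u)}

lemma stE_iff {P : Type*} [PartialOrder P] (z : P) (S : Finset P) (V : Finset ℕ) (p : ℕ)
    (β : Bool) (f : P → ℕ) : f ∈ stE z S V p ↔ (∀ x, x ∉ S → f x = p) ∧ Set.BijOn f S V ∧
    (∀ u ∈ S, ∀ w ∈ S, stR β u w → stR β (f u) (f w)) ∧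
    (∀ u ∈ S, stR β u z → stR β (f u) p) ∧ (∀ u ∈ S, stR β z u → stR β p (f u)) := by
  cases β
  · rfl
  · simp only [stE, stR, Set.mem_setOf_eq]
    constructor
    · rintro ⟨h1, h2, h3, h4, h5⟩
      exact ⟨h1, h2, fun u hu w hw h => h3 w hw u hu h, h5, h4⟩
    · rintro ⟨h1, h2, h3, h4, h5⟩
      exact ⟨h1, h2, fun u hu w hw h => h3 w hw u hu h, h5, h4⟩

lemma stE_finite {P : Type*} [Fintype P] [PartialOrder P] (z : P) (S : Finset P)
    (V : Finset ℕ) (p : ℕ) : (stE z S V p).Finite := by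
  have : {f : P → ℕ | ∀ x, f x ∈ ((insert p V : Finset ℕ) : Set ℕ)}.Finite :=
    Set.Finite.pi' fun x => Finset.finite_toSet _
  refine this.subset fun f hf x => ?_
  by_cases hx : x ∈ S
  · have := hf.2.1.mapsTo hx
    simp only [Finset.coe_insert]
    exact Or.inr this
  · simp [hf.1 x hx]

lemma stE_rec {P : Type*} [Fintype P] [PartialOrder P] (z : P) (S : Finset P)
    (V : Finset ℕ) (p : ℕ) (β : Bool) (m : ℕ) (hmV : m ∈ V)
    (hm : ∀ v ∈ V, v ≠ m → stR β m v) (hmp : stR β m p) :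
    Nat.card (stE z S V p) =
      ∑ x, if stD z S (x, β) then Nat.card (stE z (S.erase x) (V.erase m) p) else 0 := by
  have hirr : ¬ stR β m m := by cases β <;> exact lt_irrefl m
  have fwd : ∀ x, stD z S (x, β) → ∀ g ∈ stE z (S.erase x) (V.erase m) p,
      Function.update g x m ∈ stE z S V p := by
    intro x hx g hg
    rw [stE_iff z _ _ p β] at hg ⊢
    obtain ⟨h1, h2, h3, h4, h5⟩ := hg
    have hup : ∀ u, u ≠ x → Function.update g x m u = g u := fun u hu =>
      Function.update_of_ne hu _ _
    have hx1 : x ∈ S := hx.1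
    have hgv : ∀ u ∈ S, u ≠ x → g u ∈ V ∧ g u ≠ m := by
      intro u hu hux
      have := h2.mapsTo (show u ∈ ((S.erase x : Finset P) : Set P) from
        Finset.mem_coe.2 (Finset.mem_erase.2 ⟨hux, hu⟩))
      have := Finset.mem_erase.1 (Finset.mem_coe.1 this)
      exact ⟨this.2, this.1⟩
    refine ⟨?_, ⟨?_, ?_, ?_⟩, ?_, ?_, ?_⟩
    · intro u hu
      have hux : u ≠ x := fun e => hu (e ▸ hx1)
      rw [hup u hux]
      exact h1 u (fun h => hu (Finset.mem_of_mem_erase h))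
    · intro u hu
      by_cases hux : u = x
      · subst hux; simpa using hmV
      · rw [hup u hux]; exact (hgv u hu hux).1
    · intro u hu w hw huw
      by_cases hux : u = x
      · by_cases hwx : w = x
        · rw [hux, hwx]
        · exfalso
          rw [hup w hwx, hux, Function.update_self] at huw
          exact (hgv w hw hwx).2 huw.symm
      · by_cases hwx : w = x
        · exfalso
          rw [hup u hux, hwx, Function.update_self] at huw
          exact (hgv u hu hux).2 huw
        · rw [hup u hux, hup w hwx] at huw
          exact h2.injOn (Finset.mem_coe.2 (Finset.mem_erase.2 ⟨hux, hu⟩))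
            (Finset.mem_coe.2 (Finset.mem_erase.2 ⟨hwx, hw⟩)) huw
    · intro v hv
      by_cases hvm : v = m
      · exact ⟨x, hx1, by rw [hvm, Function.update_self]⟩
      · obtain ⟨u, hu, rfl⟩ := h2.surjOn (show v ∈ ((V.erase m : Finset ℕ) : Set ℕ) from
          Finset.mem_coe.2 (Finset.mem_erase.2 ⟨hvm, hv⟩))
        have := Finset.mem_erase.1 (Finset.mem_coe.1 hu)
        exact ⟨u, this.2, hup u this.1⟩
    · intro u hu w hw huw
      by_cases hwx : w = x
      · exact absurd (hwx ▸ huw) (hx.2.2 u hu)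
      · rw [hup w hwx]
        by_cases hux : u = x
        · rw [hux, Function.update_self]
          exact hm _ (hgv w hw hwx).1 (hgv w hw hwx).2
        · rw [hup u hux]
          exact h3 u (Finset.mem_erase.2 ⟨hux, hu⟩) w (Finset.mem_erase.2 ⟨hwx, hw⟩) huw
    · intro u hu huz
      by_cases hux : u = x
      · rw [hux, Function.update_self]; exact hmp
      · rw [hup u hux]; exact h4 u (Finset.mem_erase.2 ⟨hux, hu⟩) huz
    · intro u hu huz
      by_cases hux : u = x
      · exact absurd (hux ▸ huz) hx.2.1
      · rw [hup u hux]; exact h5 u (Finset.mem_erase.2 ⟨hux, hu⟩) huz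
  have bwd : ∀ f ∈ stE z S V p, ∃ x, stD z S (x, β) ∧ f x = m ∧
      Function.update f x p ∈ stE z (S.erase x) (V.erase m) p := by
    intro f hf
    rw [stE_iff z _ _ p β] at hf
    obtain ⟨h1, h2, h3, h4, h5⟩ := hf
    obtain ⟨x, hx, hxm⟩ := h2.surjOn (Finset.mem_coe.2 hmV)
    have hx1 : x ∈ S := hx
    have hup : ∀ u, u ≠ x → Function.update f x p u = f u := fun u hu =>
      Function.update_of_ne hu _ _
    have hfm : ∀ u ∈ S, u ≠ x → f u ≠ m := fun u hu hux e =>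
      hux (h2.injOn hu hx (e.trans hxm.symm))
    refine ⟨x, ⟨hx1, ?_, ?_⟩, hxm, ?_⟩
    · intro h
      have := h5 x hx1 h
      rw [hxm] at this
      exact stR_asymm hmp this
    · intro y hy h
      have h6 := h3 y hy x hx1 h
      simp only [hxm] at h6
      have hyx : y ≠ x := by
        rintro rfl
        rw [hxm] at h6; exact hirr h6
      exact stR_asymm (hm _ (h2.mapsTo hy) (hfm y hy hyx)) h6
    · rw [stE_iff z _ _ p β]
      refine ⟨?_, ⟨?_, ?_, ?_⟩, ?_, ?_, ?_⟩
      · intro u hu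
        by_cases hux : u = x
        · rw [hux, Function.update_self]
        · rw [hup u hux]; exact h1 u (fun h => hu (Finset.mem_erase.2 ⟨hux, h⟩))
      · intro u hu
        obtain ⟨hux, huS⟩ := Finset.mem_erase.1 (Finset.mem_coe.1 hu)
        rw [hup u hux]
        exact Finset.mem_coe.2 (Finset.mem_erase.2 ⟨hfm u huS hux, h2.mapsTo huS⟩)
      · intro u hu w hw huw
        obtain ⟨hux, huS⟩ := Finset.mem_erase.1 (Finset.mem_coe.1 hu)
        obtain ⟨hwx, hwS⟩ := Finset.mem_erase.1 (Finset.mem_coe.1 hw)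
        rw [hup u hux, hup w hwx] at huw
        exact h2.injOn huS hwS huw
      · intro v hv
        obtain ⟨hvm, hvV⟩ := Finset.mem_erase.1 (Finset.mem_coe.1 hv)
        obtain ⟨u, hu, rfl⟩ := h2.surjOn (Finset.mem_coe.2 hvV)
        have hux : u ≠ x := fun e => hvm (e ▸ hxm)
        exact ⟨u, Finset.mem_coe.2 (Finset.mem_erase.2 ⟨hux, hu⟩), hup u hux⟩
      · intro u hu w hw huw
        obtain ⟨hux, huS⟩ := Finset.mem_erase.1 hu
        obtain ⟨hwx, hwS⟩ := Finset.mem_erase.1 hw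
        rw [hup u hux, hup w hwx]
        exact h3 u huS w hwS huw
      · intro u hu huz
        obtain ⟨hux, huS⟩ := Finset.mem_erase.1 hu
        rw [hup u hux]
        exact h4 u huS huz
      · intro u hu huz
        obtain ⟨hux, huS⟩ := Finset.mem_erase.1 hu
        rw [hup u hux]
        exact h5 u huS huz
  let Φ : (Σ x : {x // stD z S (x, β)}, stE z (S.erase x.1) (V.erase m) p) → stE z S V p :=
    fun q => ⟨Function.update q.2.1 q.1.1 m, fwd q.1.1 q.1.2 q.2.1 q.2.2⟩
  have hΦ : Function.Bijective Φ := by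
    constructor
    · rintro ⟨⟨x, hx⟩, ⟨g, hg⟩⟩ ⟨⟨x', hx'⟩, ⟨g', hg'⟩⟩ heq
      have heq' : Function.update g x m = Function.update g' x' m := congrArg Subtype.val heq
      have hxx : x = x' := by
        by_contra hne
        have h1 := congrFun heq' x
        rw [Function.update_self, Function.update_of_ne hne] at h1
        have h2 := hg'.2.1.mapsTo (Finset.mem_coe.2 (Finset.mem_erase.2 ⟨hne, hx.1⟩))
        exact (Finset.mem_erase.1 (Finset.mem_coe.1 h2)).1 h1.symm
      subst hxx
      have hgg : g = g' := by
        funext u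
        by_cases hu : u = x
        · subst hu
          rw [hg.1 u (Finset.notMem_erase _ _), hg'.1 u (Finset.notMem_erase _ _)]
        · have := congrFun heq' u
          rwa [Function.update_of_ne hu, Function.update_of_ne hu] at this
      subst hgg
      rfl
    · rintro ⟨f, hf⟩
      obtain ⟨x, hx, hxm, hg⟩ := bwd f hf
      refine ⟨⟨⟨x, hx⟩, ⟨_, hg⟩⟩, Subtype.ext ?_⟩
      change Function.update (Function.update f x p) x m = f
      rw [Function.update_idem, ← hxm, Function.update_eq_self]
  haveI : ∀ x : {x // stD z S (x, β)}, Finite (stE z (S.erase x.1) (V.erase m) p) :=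
    fun x => (stE_finite _ _ _ _).to_subtype
  rw [← Nat.card_congr (Equiv.ofBijective Φ hΦ), Nat.card_sigma, ← Finset.sum_filter]
  exact Finset.sum_subtype (p := fun x => stD z S (x, β)) _ (by simp)
    (fun x => Nat.card (stE z (S.erase x) (V.erase m) p)) |>.symm

lemma stE_card {P : Type*} [Fintype P] [PartialOrder P] (z : P) (p : ℕ) (a b : ℕ) :
    ∀ (S : Finset P) (V : Finset ℕ), (V.filter (· < p)).card = a → (V.filter (p < ·)).card = b →
    p ∉ V → (Nat.card (stE z S V p) : ℝ) = stF z a b S := by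
  induction a with
  | zero =>
    induction b with
    | zero =>
      intro S V ha hb hp
      have hV : V = ∅ := by
        rw [Finset.eq_empty_iff_forall_notMem]
        intro v hv
        rcases lt_trichotomy v p with h | h | h
        · exact Finset.notMem_empty v (Finset.card_eq_zero.1 ha ▸ Finset.mem_filter.2 ⟨hv, h⟩)
        · exact hp (h ▸ hv)
        · exact Finset.notMem_empty v (Finset.card_eq_zero.1 hb ▸ Finset.mem_filter.2 ⟨hv, h⟩)
      subst hV
      rw [stF]
      split_ifs with hS
      · subst hS
        have : stE z ∅ ∅ p = {fun _ => p} := by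
          ext f
          simp only [stE, Set.mem_setOf_eq, Set.mem_singleton_iff]
          constructor
          · rintro ⟨h, -⟩; funext x; exact h x (Finset.notMem_empty x)
          · rintro rfl; simp
        rw [this]; simp
      · have : stE z S ∅ p = ∅ := by
          rw [Set.eq_empty_iff_forall_notMem]
          rintro f ⟨-, h, -⟩
          obtain ⟨x, hx⟩ := Finset.nonempty_iff_ne_empty.2 hS
          have := h.mapsTo (Finset.mem_coe.2 hx)
          simp at this
        rw [this]; simp
    | succ b ih =>
      intro S V ha hb hp
      have hne : (V.filter (p < ·)).Nonempty := Finset.card_pos.1 (by omega)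
      obtain ⟨v0, hv0⟩ := hne
      rw [Finset.mem_filter] at hv0
      have hVne : V.Nonempty := ⟨v0, hv0.1⟩
      have hmV := Finset.max'_mem V hVne
      have hle : ∀ v ∈ V, v ≤ V.max' hVne := fun v hv => Finset.le_max' V v hv
      set m := V.max' hVne
      have hpm : p < m := lt_of_lt_of_le hv0.2 (hle _ hv0.1)
      rw [stE_rec z S V p true m hmV (fun v hv hne => lt_of_le_of_ne (hle v hv) hne) hpm, stF_top]
      push_cast
      refine Finset.sum_congr rfl fun x _ => ?_
      split_ifs
      · refine ih _ _ ?_ ?_ (fun h => hp (Finset.mem_of_mem_erase h))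
        · rw [Finset.filter_erase, Finset.erase_eq_of_notMem, ha]
          simp; intro _; omega
        · rw [Finset.filter_erase, Finset.card_erase_of_mem (by simp [hmV, hpm]), hb]; rfl
      · rfl
  | succ a ih =>
    intro S V ha hb hp
    have hne : (V.filter (· < p)).Nonempty := Finset.card_pos.1 (by omega)
    obtain ⟨v0, hv0⟩ := hne
    rw [Finset.mem_filter] at hv0
    have hVne : V.Nonempty := ⟨v0, hv0.1⟩
    have hmV := Finset.min'_mem V hVne
    have hle : ∀ v ∈ V, V.min' hVne ≤ v := fun v hv => Finset.min'_le V v hv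
    set m := V.min' hVne
    have hpm : m < p := lt_of_le_of_lt (hle _ hv0.1) hv0.2
    rw [stE_rec z S V p false m hmV (fun v hv hne => lt_of_le_of_ne (hle v hv) hne.symm) hpm,
      stF_bot]
    push_cast
    refine Finset.sum_congr rfl fun x _ => ?_
    split_ifs
    · refine ih _ _ ?_ ?_ (fun h => hp (Finset.mem_of_mem_erase h))
      · rw [Finset.filter_erase, Finset.card_erase_of_mem (by simp [hmV, hpm]), ha]; rfl
      · rw [Finset.filter_erase, Finset.erase_eq_of_notMem, hb]
        simp; intro _; omega
    · rfl

end StanleyCombinatorics3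

open Classical in
lemma st_hgt (P : Type*) [Fintype P] [PartialOrder P] (z : P) (a b : ℕ)
    (h : Fintype.card P = a + b + 1) :
    (hgt P z a : ℝ) = stF z a b (Finset.univ.erase z) := by
  rw [← stE_card z a a b (Finset.univ.erase z) ((Finset.range (Fintype.card P)).erase a)]
  · unfold hgt
    norm_cast
    let Ψ : {φ : P ≃ Fin (Fintype.card P) //
        Monotone ⇑φ ∧ ((φ z : Fin (Fintype.card P)) : ℕ) = a} →
        stE z (Finset.univ.erase z) ((Finset.range (Fintype.card P)).erase a) a := fun φ =>
      ⟨fun x => (φ.1 x : ℕ), by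
        obtain ⟨φ, hm, hz⟩ := φ
        have hst : ∀ u w, u < w → (φ u : ℕ) < φ w := by
          intro u w huw
          have := (hm huw.le).lt_of_ne (fun e => huw.ne (φ.injective e))
          exact this
        refine ⟨?_, ⟨?_, ?_, ?_⟩, fun u _ w _ huw => hst u w huw, ?_, ?_⟩
        · intro x hx
          have : x = z := by simpa using hx
          rw [this]; exact hz
        · intro x hx
          have hxz : x ≠ z := by simpa using hx
          have : (φ x : ℕ) ≠ a := fun e => hxz (φ.injective (Fin.ext (e.trans hz.symm)))
          simp [this]
        · intro x _ y _ hxy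
          exact φ.injective (Fin.ext hxy)
        · intro v hv
          simp only [Finset.coe_erase, Finset.coe_range, Set.mem_sdiff, Set.mem_Iio,
            Set.mem_singleton_iff] at hv
          refine ⟨φ.symm ⟨v, hv.1⟩, ?_, by simp⟩
          simp only [Finset.coe_erase, Finset.coe_univ, Set.mem_sdiff, Set.mem_univ, true_and,
            Set.mem_singleton_iff]
          intro e
          rw [← e] at hz
          simp at hz
          exact hv.2 hz
        · intro u _ huz
          exact lt_of_lt_of_eq (hst u z huz) hz
        · intro u _ huz
          have := hst z u huz
          rwa [hz] at this⟩
    refine Nat.card_congr (Equiv.ofBijective Ψ ⟨?_, ?_⟩)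
    · intro φ ψ hφψ
      apply Subtype.ext
      apply Equiv.ext
      intro x
      have := congrFun (congrArg Subtype.val hφψ) x
      exact Fin.ext this
    · rintro ⟨f, hf⟩
      obtain ⟨h1, h2, h3, h4, h5⟩ := hf
      have hfz : f z = a := h1 z (by simp)
      have hfne : ∀ x, x ≠ z → f x < Fintype.card P ∧ f x ≠ a := by
        intro x hx
        have := h2.mapsTo (show x ∈ ((Finset.univ.erase z : Finset P) : Set P) by simp [hx])
        simp at this
        exact this
      have hlt : ∀ x, f x < Fintype.card P := by
        intro x
        by_cases hx : x = z
        · rw [hx, hfz]; omega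
        · exact (hfne x hx).1
      have hinj : Function.Injective (fun x => (⟨f x, hlt x⟩ : Fin (Fintype.card P))) := by
        intro x y hxy
        have hxy : f x = f y := congrArg Fin.val hxy
        by_cases hx : x = z
        · by_cases hy : y = z
          · rw [hx, hy]
          · rw [hx, hfz] at hxy
            exact absurd hxy.symm (hfne y hy).2
        · by_cases hy : y = z
          · rw [hy, hfz] at hxy
            exact absurd hxy (hfne x hx).2
          · exact h2.injOn (by simp [hx]) (by simp [hy]) hxy
      have hbij : Function.Bijective (fun x => (⟨f x, hlt x⟩ : Fin (Fintype.card P))) :=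
        (Fintype.bijective_iff_injective_and_card _).2 ⟨hinj, by simp⟩
      refine ⟨⟨Equiv.ofBijective _ hbij, ?_, hfz⟩, Subtype.ext rfl⟩
      intro x y hxy
      change f x ≤ f y
      rcases hxy.eq_or_lt with rfl | hxy
      · exact le_rfl
      · by_cases hx : x = z
        · subst hx
          rw [hfz]
          exact (h5 y (by simp [hxy.ne']) hxy).le
        · by_cases hy : y = z
          · subst hy
            rw [hfz]
            exact (h4 x (by simp [hxy.ne]) hxy).le
          · exact (h3 x (by simp [hx]) y (by simp [hy]) hxy).le
  · have : ((Finset.range (Fintype.card P)).erase a).filter (· < a) = Finset.range a := by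
      ext v; simp only [Finset.mem_filter, Finset.mem_erase, Finset.mem_range]; omega
    rw [this, Finset.card_range]
  · have : ((Finset.range (Fintype.card P)).erase a).filter (a < ·) =
        Finset.Ioo a (a + b + 1) := by
      ext v; simp only [Finset.mem_filter, Finset.mem_erase, Finset.mem_range, Finset.mem_Ioo]; omega
    rw [this, Nat.card_Ioo]; omega
  · simp

lemma st_decr (P : Type*) [Fintype P] [PartialOrder P] (v : P)
    (hv : ∀ w : P, w ≠ v → (w ≤ v ∨ v ≤ w) → v ≤ w) (k : ℕ) (hk : k < Fintype.card P - 1) :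
    hgt P v (k + 1) ≤ hgt P v k := by
  unfold hgt
  let A : Fin (Fintype.card P) := ⟨k, by omega⟩
  let B : Fin (Fintype.card P) := ⟨k + 1, by omega⟩
  have hsw : ∀ c : Fin (Fintype.card P), ((Equiv.swap A B c : Fin (Fintype.card P)) : ℕ) =
      if (c : ℕ) = k then k + 1 else if (c : ℕ) = k + 1 then k else c := by
    intro c
    rw [Equiv.swap_apply_def]
    simp only [Fin.ext_iff, A, B]
    split_ifs <;> rfl
  refine Nat.card_le_card_of_injective
    (fun φ : {φ : P ≃ Fin (Fintype.card P) //
      Monotone ⇑φ ∧ ((φ v : Fin (Fintype.card P)) : ℕ) = k + 1} =>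
      (⟨φ.1.trans (Equiv.swap A B), ?_, ?_⟩ : {φ : P ≃ Fin (Fintype.card P) //
      Monotone ⇑φ ∧ ((φ v : Fin (Fintype.card P)) : ℕ) = k})) ?_
  · obtain ⟨φ, hm, hz⟩ := φ
    intro x y hxy
    have h1 : (φ x : ℕ) ≤ φ y := hm hxy
    rw [Fin.le_def]
    simp only [Equiv.trans_apply, hsw]
    have h2 : ¬ ((φ x : ℕ) = k ∧ (φ y : ℕ) = k + 1) := by
      rintro ⟨hx, hy⟩
      have hyv : y = v := φ.injective (Fin.ext (hy.trans hz.symm))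
      subst hyv
      have hne : x ≠ y := by rintro rfl; omega
      have := hv x hne (Or.inl hxy)
      exact hne (le_antisymm hxy this)
    split_ifs <;> omega
  · obtain ⟨φ, hm, hz⟩ := φ
    simp only [Equiv.trans_apply, hsw, hz]
    simp
  · intro φ ψ hφψ
    have := congrArg Subtype.val hφψ
    apply Subtype.ext
    apply Equiv.ext
    intro x
    have := congrArg (fun e : P ≃ Fin (Fintype.card P) => e x) this
    simpa using this

/-- For a finite poset `P` and `v ∈ P`, the sequence
`{h_k(P,v)}_{k=0}^{|P|−1}` is log-concave; moreover, if every element comparable with `v`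
and distinct from `v` is greater than `v`, then the sequence is also decreasing. -/
theorem stmt2 (P : Type*) [Fintype P] [PartialOrder P] (v : P) :
    (∀ k : ℕ, 0 < k → k < Fintype.card P - 1 →
        hgt P v (k - 1) * hgt P v (k + 1) ≤ (hgt P v k) ^ 2) ∧
    ((∀ w : P, w ≠ v → (w ≤ v ∨ v ≤ w) → v ≤ w) →
        ∀ k : ℕ, k < Fintype.card P - 1 → hgt P v (k + 1) ≤ hgt P v k) := by
  classical
  refine ⟨fun k hk0 hk => ?_, fun hv k hk => st_decr P v hv k hk⟩
  obtain ⟨a, rfl⟩ : ∃ a, k = a + 1 := ⟨k - 1, by omega⟩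
  obtain ⟨b, hb⟩ : ∃ b, Fintype.card P = a + b + 3 := ⟨Fintype.card P - a - 3, by omega⟩
  have h1 := st_hgt P v a (b + 2) (by omega)
  have h2 := st_hgt P v (a + 1) (b + 1) (by omega)
  have h3 := st_hgt P v (a + 2) b (by omega)
  have key := stF_logconcave (z := v) a b (Finset.univ.erase v) (by
    rw [Finset.card_erase_of_mem (Finset.mem_univ v), Finset.card_univ]; omega)
  have : ((hgt P v a : ℝ) * hgt P v (a + 2)) ≤ (hgt P v (a + 1) : ℝ) ^ 2 := by
    rw [h1, h2, h3]; convert key using 3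
  simpa using (by exact_mod_cast this : hgt P v a * hgt P v (a + 2) ≤ hgt P v (a + 1) ^ 2)
end

section
/- For every finite set I of positive integers with m = max(I ∪ {0}) and every 0 ≤ k ≤ m, the coefficient c_k(I) is a non-negative integer. -/
/-- `IsCCoeff I c` says that `c` is the coefficient sequence of the descent polynomial
of `I` in the basis `{C(n+1,k)}_{k=0}^{m}` with signs `(−1)^{m−k}`, i.e.
`d(I,n) = Σ_{k=0}^{m} (−1)^{m−k} c_k·C(n+1,k)` for all integers `n > m`,
together with `c_k = 0` for `k > m`.  (These conditions determine `c` uniquely.) -/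
def IsCCoeff (I : Finset ℕ) (c : ℕ → ℚ) : Prop :=
  (∀ n : ℕ, mI I < n →
      (dCount I n : ℚ) =
        ∑ k ∈ Finset.range (mI I + 1),
          (-1 : ℚ) ^ (mI I - k) * c k * ((n + 1).choose k)) ∧
  (∀ k : ℕ, mI I < k → c k = 0)

/-- Permutations of `Fin (n+1)` whose descents match `I`. -/
def Good (I : Finset ℕ) (n : ℕ) (σ : Equiv.Perm (Fin (n + 1))) : Prop :=
  ∀ i : Fin n, ((i : ℕ) + 1 ∈ I ↔ σ i.succ < σ i.castSucc)

open Classical in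
/-- Number of good permutations with last value `j`. -/
noncomputable def cnt (I : Finset ℕ) (n j : ℕ) : ℕ :=
  (Finset.univ.filter (fun σ : Equiv.Perm (Fin (n + 1)) =>
    Good I n σ ∧ (σ (Fin.last n) : ℕ) = j)).card

/-- Total number of good permutations. -/
noncomputable def tot (I : Finset ℕ) (n : ℕ) : ℕ := ∑ j ∈ Finset.range (n + 1), cnt I n j

/-- Extend a permutation by a last value. -/
def ext1 (n : ℕ) (j : Fin (n + 2)) (σ : Equiv.Perm (Fin (n + 1))) : Equiv.Perm (Fin (n + 2)) :=
  ((finSuccEquiv' (Fin.last (n + 1))).trans (Equiv.optionCongr σ)).trans (finSuccEquiv' j).symm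

lemma ext1_last (n : ℕ) (j : Fin (n + 2)) (σ) : ext1 n j σ (Fin.last (n + 1)) = j := by
  simp [ext1]

lemma ext1_castSucc (n : ℕ) (j : Fin (n + 2)) (σ) (i : Fin (n + 1)) :
    ext1 n j σ i.castSucc = j.succAbove (σ i) := by
  have : (finSuccEquiv' (Fin.last (n + 1))) i.castSucc = some i := by
    rw [← Fin.succAbove_last_apply, finSuccEquiv'_succAbove]
  simp [ext1, this]

lemma ext1_inj (n : ℕ) : Function.Injective
    (fun x : Fin (n + 2) × Equiv.Perm (Fin (n + 1)) => ext1 n x.1 x.2) := by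
  rintro ⟨j, σ⟩ ⟨j', σ'⟩ h
  simp only at h
  have hj : j = j' := by
    rw [← ext1_last n j σ, h, ext1_last]
  subst hj
  congr 1
  ext1 i
  have := ext1_castSucc n j σ i
  rw [h, ext1_castSucc] at this
  exact (Fin.succAbove_right_injective this).symm

lemma ext1_bij (n : ℕ) : Function.Bijective
    (fun x : Fin (n + 2) × Equiv.Perm (Fin (n + 1)) => ext1 n x.1 x.2) := by
  rw [Fintype.bijective_iff_injective_and_card]
  refine ⟨ext1_inj n, ?_⟩
  simp [Fintype.card_perm, Nat.factorial_succ]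

lemma good_ext1 (I : Finset ℕ) (n : ℕ) (j : Fin (n + 2)) (σ) :
    Good I (n + 1) (ext1 n j σ) ↔
      Good I n σ ∧ (n + 1 ∈ I ↔ (j : ℕ) ≤ (σ (Fin.last n) : ℕ)) := by
  unfold Good
  rw [Fin.forall_fin_succ']
  apply and_congr
  · apply forall_congr'
    intro i
    rw [Fin.succ_castSucc, ext1_castSucc, ext1_castSucc]
    simp [Fin.succAbove_lt_succAbove_iff]
  · rw [Fin.succ_last, ext1_last, ext1_castSucc, Fin.lt_succAbove_iff_le_castSucc]
    simp [Fin.le_def]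

open Classical in
lemma cnt_succ (I : Finset ℕ) (n j : ℕ) (hj : j ≤ n + 1) :
    cnt I (n + 1) j =
      ∑ i ∈ (Finset.range (n + 1)).filter (fun i => (n + 1 ∈ I ↔ j ≤ i)), cnt I n i := by
  have h1 : cnt I (n + 1) j = (Finset.univ.filter (fun σ : Equiv.Perm (Fin (n + 1)) =>
      Good I n σ ∧ (n + 1 ∈ I ↔ j ≤ (σ (Fin.last n) : ℕ)))).card := by
    unfold cnt
    symm
    apply Finset.card_bij (fun σ _ => ext1 n ⟨j, by omega⟩ σ)
    · intro σ hσ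
      simp only [Finset.mem_filter, Finset.mem_univ, true_and] at hσ ⊢
      exact ⟨(good_ext1 I n _ σ).2 hσ, by rw [ext1_last]⟩
    · intro σ _ τ _ h
      have := @ext1_inj n (⟨j, by omega⟩, σ) (⟨j, by omega⟩, τ) h
      simpa using this
    · intro π hπ
      simp only [Finset.mem_filter, Finset.mem_univ, true_and] at hπ
      obtain ⟨⟨j', σ⟩, rfl⟩ := (ext1_bij n).2 π
      simp only [ext1_last] at hπ
      obtain ⟨hg, rfl⟩ := hπ
      refine ⟨σ, ?_, rfl⟩
      simp only [Finset.mem_filter, Finset.mem_univ, true_and]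
      exact (good_ext1 I n _ σ).1 hg
  rw [h1, Finset.card_eq_sum_card_fiberwise (f := fun σ => (σ (Fin.last n) : ℕ))
    (t := (Finset.range (n + 1)).filter (fun i => (n + 1 ∈ I ↔ j ≤ i)))]
  · apply Finset.sum_congr rfl
    intro i hi
    simp only [Finset.mem_filter, Finset.mem_range] at hi
    unfold cnt
    congr 1
    ext σ
    simp only [Finset.mem_filter, Finset.mem_univ, true_and]
    constructor
    · rintro ⟨⟨a, b⟩, c⟩; exact ⟨a, c⟩
    · rintro ⟨a, c⟩; exact ⟨⟨a, by rw [c]; exact hi.2⟩, c⟩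
  · intro σ hσ
    simp only [Finset.coe_filter, Finset.mem_univ, true_and, Set.mem_ofPred_eq,
      Finset.mem_range] at hσ ⊢
    exact ⟨Fin.is_lt _, hσ.2⟩

lemma cnt_succ_asc (I : Finset ℕ) (n j : ℕ) (hj : j ≤ n + 1) (hI : n + 1 ∉ I) :
    cnt I (n + 1) j = ∑ i ∈ Finset.range j, cnt I n i := by
  rw [cnt_succ I n j hj]
  refine Finset.sum_congr ?_ (fun _ _ => rfl)
  ext i
  simp only [Finset.mem_filter, Finset.mem_range, hI, false_iff]
  omega

lemma cnt_congr (I J : Finset ℕ) (n j : ℕ) (h : ∀ i ≤ n, (i ∈ I ↔ i ∈ J)) :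
    cnt I n j = cnt J n j := by
  have : ∀ σ, Good I n σ ↔ Good J n σ := fun σ =>
    forall_congr' fun i => by rw [h _ (by have := i.2; omega)]
  unfold cnt
  congr 1
  ext σ
  simp only [Finset.mem_filter, this σ]

lemma tot_succ_asc_ge (I : Finset ℕ) (n : ℕ) (hI : n + 1 ∉ I) : tot I n ≤ tot I (n + 1) := by
  have : tot I n = cnt I (n + 1) (n + 1) := by rw [cnt_succ_asc I n _ le_rfl hI]; rfl
  rw [this, tot]
  exact Finset.single_le_sum (f := fun j => cnt I (n + 1) j) (fun _ _ => Nat.zero_le _) (by simp)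

lemma tot_succ_asc_le (I : Finset ℕ) (n : ℕ) (hI : n + 1 ∉ I) :
    tot I (n + 1) ≤ (n + 1) * tot I n := by
  rw [tot, Finset.sum_range_succ', cnt_succ_asc I n 0 (by omega) hI]
  simp only [Finset.range_zero, Finset.sum_empty, add_zero]
  calc _ ≤ ∑ j ∈ Finset.range (n + 1), tot I n := by
        apply Finset.sum_le_sum
        intro j hj
        have := Finset.mem_range.1 hj
        rw [cnt_succ_asc I n _ (by omega) hI]
        exact Finset.sum_le_sum_of_subset (Finset.range_subset_range.2 (by omega))
    _ = _ := by simp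

lemma tot_C (I J : Finset ℕ) (p : ℕ) (hIJ : ∀ i ≤ p, (i ∈ I ↔ i ∈ J)) (hp : p + 1 ∈ I)
    (hp2 : p + 2 ∉ I) (hpJ : p + 1 ∉ J) :
    tot J p + tot J (p + 1) ≤ tot I (p + 2) := by
  have h0 : cnt I (p + 1) 0 = tot J p := by
    rw [cnt_succ I p 0 (by omega), tot]
    simp [hp]
    exact Finset.sum_congr rfl fun i _ => cnt_congr I J p i hIJ
  have h1 : (p + 2) * tot J p ≤ tot I (p + 2) := by
    rw [← h0, tot, Finset.sum_range_succ']
    calc _ = ∑ j ∈ Finset.range (p + 2), cnt I (p + 1) 0 := by simp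
      _ ≤ ∑ j ∈ Finset.range (p + 2), cnt I (p + 2) (j + 1) := by
        apply Finset.sum_le_sum
        intro j hj
        have := Finset.mem_range.1 hj
        rw [cnt_succ_asc I (p + 1) _ (by omega) hp2]
        exact Finset.single_le_sum (f := fun j => cnt I (p + 1) j)
          (fun _ _ => Nat.zero_le _) (by simp)
      _ ≤ _ := by omega
  have h2 := tot_succ_asc_le J p hpJ
  nlinarith

lemma sum_choose_range (k j : ℕ) : ∑ i ∈ Finset.range j, i.choose k = j.choose (k + 1) := by
  induction j with
  | zero => simp
  | succ j ih => rw [Finset.sum_range_succ, ih, Nat.choose_succ_succ', add_comm]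

lemma cnt_A (I J : Finset ℕ) (p : ℕ) (hIJ : ∀ i ≤ p, (i ∈ I ↔ i ∈ J)) (hp : p + 1 ∈ I)
    (hI : ∀ i > p + 1, i ∉ I) (hJ : ∀ i > p, i ∉ J) (k : ℕ) :
    ∀ j ≤ p + 1 + k, cnt I (p + 1 + k) j + cnt J (p + 1 + k) j = j.choose k * tot J p := by
  induction k with
  | zero =>
    intro j hj
    simp only [add_zero] at hj ⊢
    rw [cnt_succ I p j hj, cnt_succ J p j hj, tot]
    simp only [hp, hJ (p + 1) (by omega), true_iff, false_iff, Nat.choose_zero_right, one_mul]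
    rw [Finset.sum_congr rfl fun i _ => cnt_congr I J p i hIJ]
    exact Finset.sum_filter_add_sum_filter_not _ _ _
  | succ k ih =>
    intro j hj
    rw [← add_assoc, cnt_succ_asc I _ j (by omega) (hI _ (by omega)),
      cnt_succ_asc J _ j (by omega) (hJ _ (by omega)), ← Finset.sum_add_distrib,
      ← sum_choose_range, Finset.sum_mul]
    apply Finset.sum_congr rfl
    intro i hi
    have := Finset.mem_range.1 hi
    exact ih i (by omega)

lemma tot_A (I J : Finset ℕ) (p : ℕ) (hIJ : ∀ i ≤ p, (i ∈ I ↔ i ∈ J)) (hp : p + 1 ∈ I)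
    (hI : ∀ i > p + 1, i ∉ I) (hJ : ∀ i > p, i ∉ J) (k : ℕ) :
    tot I (p + 1 + k) + tot J (p + 1 + k) = (p + 1 + k + 1).choose (p + 1) * tot J p := by
  rw [tot, tot, ← Finset.sum_add_distrib,
    Finset.sum_congr rfl fun j hj => cnt_A I J p hIJ hp hI hJ k j
      (by have := Finset.mem_range.1 hj; omega), ← Finset.sum_mul, sum_choose_range]
  congr 1
  exact Nat.choose_symm_of_eq_add (by omega)

lemma tot_empty (n : ℕ) : tot ∅ n = 1 := by
  have h : ∀ n, ∀ j ≤ n, cnt ∅ n j = if j = n then 1 else 0 := by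
    intro n
    induction n with
    | zero =>
      intro j hj
      obtain rfl : j = 0 := by omega
      simp [cnt, Good]
    | succ n ih =>
      intro j hj
      rw [cnt_succ_asc _ _ _ hj (by simp), Finset.sum_congr rfl fun i hi => ih i
        (by have := Finset.mem_range.1 hi; omega)]
      simp
      split_ifs <;> omega
  rw [tot, Finset.sum_congr rfl fun i hi => h n i
        (by have := Finset.mem_range.1 hi; omega)]
  simp

open Classical in
lemma dCount_eq (I : Finset ℕ) (hpos : ∀ i ∈ I, 0 < i) (n : ℕ) (h : ∀ i ∈ I, i < n + 1) :
    dCount I (n + 1) = tot I n := by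
  have key : ∀ σ, descSet (n + 1) σ = I ↔ Good I n σ := by
    intro σ
    have hm : ∀ i : Fin n, ((i : ℕ) + 1 ∈ descSet (n + 1) σ ↔ σ i.succ < σ i.castSucc) := by
      intro i
      simp only [descSet, Finset.mem_filter, Finset.mem_Ioo]
      constructor
      · rintro ⟨_, _, _, h⟩; exact h
      · intro h
        have := i.2
        exact ⟨by omega, by omega, by omega, h⟩
    constructor
    · rintro rfl; exact hm
    · intro hg
      ext i
      by_cases hi : 0 < i ∧ i < n + 1
      · obtain ⟨h1, h2⟩ := hi
        obtain ⟨i, rfl⟩ : ∃ i', i = i' + 1 := ⟨i - 1, by omega⟩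
        exact (hm ⟨i, by omega⟩).trans (hg ⟨i, by omega⟩).symm
      · constructor
        · intro hh
          simp only [descSet, Finset.mem_filter, Finset.mem_Ioo] at hh
          exact absurd hh.1 hi
        · intro hh; exact absurd ⟨hpos i hh, h i hh⟩ hi
  unfold dCount
  simp only [key]
  rw [Nat.card_eq_fintype_card, Fintype.card_subtype,
    Finset.card_eq_sum_card_fiberwise (f := fun σ => (σ (Fin.last n) : ℕ))
    (t := Finset.range (n + 1))]
  · simp only [Finset.filter_filter]; rfl
  · intro σ _
    simp only [Finset.coe_range, Set.mem_Iio]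
    exact Fin.is_lt _

lemma choose_alt (n m : ℕ) : (n.choose m : ℚ) =
    ∑ k ∈ Finset.range (m + 1), (-1 : ℚ) ^ (m - k) * ((n + 1).choose k) := by
  induction m with
  | zero => simp
  | succ m ih =>
    rw [Finset.sum_range_succ]
    have : ∑ k ∈ Finset.range (m + 1), (-1 : ℚ) ^ (m + 1 - k) * ((n + 1).choose k)
        = - n.choose m := by
      rw [ih, ← Finset.sum_neg_distrib]
      apply Finset.sum_congr rfl
      intro k hk
      have := Finset.mem_range.1 hk
      rw [show m + 1 - k = (m - k) + 1 by omega, pow_succ]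
      ring
    rw [this, Nat.choose_succ_succ]
    push_cast
    simp

lemma uniq (m : ℕ) : ∀ (a : ℕ → ℚ) (N : ℕ),
    (∀ n ≥ N, ∑ k ∈ Finset.range m, a k * (n.choose k) = 0) → ∀ k < m, a k = 0 := by
  induction m with
  | zero => intro a N _ k hk; omega
  | succ m ih =>
    intro a N h
    have h1 : ∀ k < m, a (k + 1) = 0 := by
      apply ih (fun k => a (k + 1)) N
      intro n hn
      have e1 := h n hn
      have e2 := h (n + 1) (by omega)
      rw [Finset.sum_range_succ'] at e1 e2
      simp only [Nat.choose_succ_succ, Nat.cast_add, mul_add, Finset.sum_add_distrib] at e1 e2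
      simp at e1 e2
      linarith
    intro k hk
    cases k with
    | succ k => exact h1 k (by omega)
    | zero =>
      have e := h N le_rfl
      rw [Finset.sum_range_succ', Finset.sum_eq_zero] at e
      · simpa using e
      · intro x hx
        rw [h1 x (Finset.mem_range.1 hx)]; simp

lemma le_mI (I : Finset ℕ) (i : ℕ) (h : i ∈ I) : i ≤ mI I := Finset.le_sup (f := id) h

lemma tot_mono (J : Finset ℕ) (a b : ℕ) (hab : a ≤ b) (h : ∀ i > a, i ∉ J) :
    tot J a ≤ tot J b := by
  induction b, hab using Nat.le_induction with
  | base => exact le_rfl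
  | succ b hb ih => exact ih.trans (tot_succ_asc_ge J b (h _ (by omega)))

lemma exists_coeff (I : Finset ℕ) : (∀ i ∈ I, 0 < i) → ∃ b : ℕ → ℕ,
    IsCCoeff I (fun k => (b k : ℚ)) ∧ ∀ k, b k ≤ tot I (mI I + 1) := by
  induction I using Finset.induction_on_max with
  | empty =>
    intro _
    refine ⟨fun k => if k = 0 then 1 else 0, ⟨?_, ?_⟩, ?_⟩
    · intro n hn
      obtain ⟨n, rfl⟩ : ∃ i', n = i' + 1 := ⟨n - 1, by omega⟩
      rw [dCount_eq _ (by simp) _ (by simp), tot_empty]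
      simp [mI]
    · intro k hk
      have : k ≠ 0 := by omega
      simp [this]
    · intro k
      rw [tot_empty]
      dsimp only
      split_ifs <;> omega
  | insert m J hmax ih =>
    intro hpos
    have hJpos : ∀ i ∈ J, 0 < i := fun i hi => hpos i (Finset.mem_insert_of_mem hi)
    obtain ⟨b, ⟨hb1, hb2⟩, hb3⟩ := ih hJpos
    have hmpos := hpos m (Finset.mem_insert_self _ _)
    obtain ⟨p, rfl⟩ : ∃ i', m = i' + 1 := ⟨m - 1, by omega⟩
    have hmJ : mI J < p + 1 := by
      rw [mI, Finset.sup_lt_iff (by simp)]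
      exact hmax
    have hmI : mI (insert (p + 1) J) = p + 1 := by
      have : mI (insert (p + 1) J) = max (p + 1) (mI J) := by simp [mI, Finset.sup_insert]
      rw [this]; omega
    set I := insert (p + 1) J with hIdef
    have hJ : ∀ i > mI J, i ∉ J := fun i hi hh => by have := le_mI J i hh; omega
    have hI : ∀ i > p + 1, i ∉ I := fun i hi hh => by have := le_mI I i hh; omega
    have hIJ : ∀ i ≤ p, (i ∈ I ↔ i ∈ J) := by
      intro i hi
      have : i ≠ p + 1 := by omega
      simp [hIdef, this]
    have hp : p + 1 ∈ I := Finset.mem_insert_self _ _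
    have hJ' : ∀ i > p, i ∉ J := fun i hi => hJ i (by omega)
    have hC := tot_C I J p hIJ hp (hI _ (by omega)) (hJ' _ (by omega))
    have hup : ∀ k, b k ≤ tot J (p + 1) := fun k =>
      (hb3 k).trans (tot_mono J _ _ (by omega) (fun i hi => hJ i (by omega)))
    -- the key formula
    have hrec : ∀ b' : ℕ → ℕ, (∀ k ≤ p + 1,
        (b' k : ℚ) = tot J p - (-1 : ℚ) ^ (p + 1 - mI J) * b k) → (∀ k > p + 1, b' k = 0) →
        IsCCoeff I (fun k => (b' k : ℚ)) := by
      intro b' h1 h2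
      refine ⟨?_, ?_⟩
      · intro n hn
        rw [hmI] at hn ⊢
        have hd : (dCount I n : ℚ) = n.choose (p + 1) * tot J p - dCount J n := by
          obtain ⟨k, rfl⟩ : ∃ k, n = p + 1 + k + 1 := ⟨n - (p + 2), by omega⟩
          rw [dCount_eq I hpos _ (fun i hi => by have := le_mI I i hi; omega),
            dCount_eq J hJpos _ (fun i hi => by have := le_mI J i hi; omega)]
          have := tot_A I J p hIJ hp hI hJ' k
          rw [eq_sub_iff_add_eq]
          exact_mod_cast this
        have hJs : (dCount J n : ℚ) = ∑ k ∈ Finset.range (p + 1 + 1),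
            (-1 : ℚ) ^ (p + 1 - k) * ((-1 : ℚ) ^ (p + 1 - mI J) * b k) * ((n + 1).choose k) := by
          rw [hb1 n (by omega)]
          rw [← Finset.sum_subset (Finset.range_subset_range.2
            (show mI J + 1 ≤ p + 1 + 1 by omega))]
          · apply Finset.sum_congr rfl
            intro k hk
            have := Finset.mem_range.1 hk
            rw [show p + 1 - k = (p + 1 - mI J) + (mI J - k) by omega, pow_add]
            have e : (-1 : ℚ) ^ (p + 1 - mI J) * (-1 : ℚ) ^ (p + 1 - mI J) = 1 := by
              rw [← mul_pow]; simp
            linear_combination (-(-1 : ℚ) ^ (mI J - k) * b k * ((n + 1).choose k)) * e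
          · intro k _ hk
            have hk' : mI J < k := by
              by_contra hh; exact hk (Finset.mem_range.2 (by omega))
            have := hb2 k hk'
            simp only at this
            rw [this]; simp
        rw [hd, hJs, choose_alt, Finset.sum_mul, ← Finset.sum_sub_distrib]
        apply Finset.sum_congr rfl
        intro k hk
        have := Finset.mem_range.1 hk
        dsimp only
        rw [h1 k (by omega)]
        ring
      · intro k hk
        rw [hmI] at hk
        simp [h2 k hk]
    rcases Nat.even_or_odd (p + 1 - mI J) with he | ho
    · have hle : ∀ k, b k ≤ tot J p := fun k => by
        obtain ⟨r, hr⟩ := he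
        exact (hb3 k).trans (tot_mono J _ _ (by omega) (fun i hi => hJ i (by omega)))
      refine ⟨fun k => if k ≤ p + 1 then tot J p - b k else 0, hrec _ ?_ ?_, ?_⟩
      · intro k hk
        simp only [hk, if_true]
        rw [he.neg_one_pow, Nat.cast_sub (hle k)]; ring
      · intro k hk
        simp [show ¬ k ≤ p + 1 by omega]
      · intro k
        rw [hmI, show p + 1 + 1 = p + 2 from rfl]
        dsimp only
        split_ifs <;> omega
    · refine ⟨fun k => if k ≤ p + 1 then tot J p + b k else 0, hrec _ ?_ ?_, ?_⟩
      · intro k hk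
        simp only [hk, if_true]
        rw [ho.neg_one_pow]; push_cast; ring
      · intro k hk
        simp [show ¬ k ≤ p + 1 by omega]
      · intro k
        have := hup k
        rw [hmI, show p + 1 + 1 = p + 2 from rfl]
        dsimp only
        split_ifs <;> omega

/-- For every finite set `I` of positive integers with `m = max(I ∪ {0})`
and every `0 ≤ k ≤ m`, the coefficient `c_k(I)` is a non-negative integer. -/
theorem stmt5 (I : Finset ℕ) (hpos : ∀ i ∈ I, 0 < i)
    (c : ℕ → ℚ) (hc : IsCCoeff I c) :
    ∀ k : ℕ, k ≤ mI I → ∃ N : ℕ, c k = N := by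
  obtain ⟨b, hb, _⟩ := exists_coeff I hpos
  intro k hk
  refine ⟨b k, ?_⟩
  have := uniq (mI I + 1) (fun k => (-1 : ℚ) ^ (mI I - k) * (c k - b k)) (mI I + 2) (by
    intro n hn
    obtain ⟨n, rfl⟩ : ∃ i', n = i' + 1 := ⟨n - 1, by omega⟩
    have h1 := hc.1 n (by omega)
    have h2 := hb.1 n (by omega)
    rw [h1, ← sub_eq_zero, ← Finset.sum_sub_distrib] at h2
    rw [← h2]
    apply Finset.sum_congr rfl
    intro k _
    ring) k (by omega)
  simp only [mul_eq_zero, pow_eq_zero_iff', neg_eq_zero, one_ne_zero, false_and, false_or] at this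
  linarith
end
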